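/- arXiv:1211.2614 — 3 statements merged into one kernel-verified Lean document; each statement's English description precedes it below -/
import Mathlib

section
/- Let G be a finite group and let G' = [G,G] be its commutator subgroup. Then D(G) ≤ d(G) + 2|G'| − 1, and equality holds if and only if G is abelian. -/
/-- The set of all products of the terms of the multiset `S` taken in some order. -/
def prodSet {G : Type*} [Group G] (S : Multiset G) : Set G :=
  {g | ∃ l : List G, (l : Multiset G) = S ∧ l.prod = g}

/-- A sequence (multiset) over `G` is a product-one sequence if its terms can be
ordered so that their product is `1`. -/
def IsProductOne {G : Type*} [Group G] (S : Multiset G) : Prop :=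
  (1 : G) ∈ prodSet S

/-- A minimal product-one sequence (atom): a nontrivial product-one sequence that cannot
be partitioned into two nontrivial product-one subsequences. -/
def IsMinimalProductOne {G : Type*} [Group G] (S : Multiset G) : Prop :=
  S ≠ 0 ∧ IsProductOne S ∧
    ¬ ∃ T₁ T₂ : Multiset G, T₁ ≠ 0 ∧ T₂ ≠ 0 ∧ S = T₁ + T₂ ∧
      IsProductOne T₁ ∧ IsProductOne T₂

/-- The small Davenport constant: the maximal length of a sequence over `G` having
no nontrivial product-one subsequence. -/
noncomputable def smallDavenport (G : Type*) [Group G] : ℕ :=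
  sSup {n | ∃ S : Multiset G, Multiset.card S = n ∧
    ∀ T : Multiset G, T ≤ S → T ≠ 0 → ¬ IsProductOne T}

/-- The large Davenport constant: the maximal length of a minimal product-one sequence. -/
noncomputable def largeDavenport (G : Type*) [Group G] : ℕ :=
  sSup {n | ∃ S : Multiset G, Multiset.card S = n ∧ IsMinimalProductOne S}

/-- A predicate on lists stable under moving the first term to the end and under swapping the
first two terms is stable under all permutations. -/
theorem List.Perm.of_rotate_of_swap {α : Type*} {P : List α → Prop}
    (rot : ∀ g t, P (g :: t) → P (t ++ [g]))
    (swap : ∀ g h t, P (g :: h :: t) → P (h :: g :: t))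
    {l l' : List α} (hl : l.Perm l') (hP : P l) : P l' := by
  have rotate : ∀ s t, P (s ++ t) → P (t ++ s) := by
    intro s
    induction s with
    | nil => intro t h; simpa using h
    | cons x s ih =>
      intro t h
      have h' := ih (t ++ [x]) (by simpa using rot _ _ h)
      simpa using h'
  suffices H : ∀ s, P (s ++ l) → P (s ++ l') from H [] hP
  clear hP
  induction hl with
  | nil => exact fun _ h => h
  | cons x _ ih => intro s h; simpa using ih (s ++ [x]) (by simpa using h)
  | swap x y l =>
    intro s h
    have h' := rotate _ _ h
    exact rotate (x :: y :: l) s (swap _ _ _ h')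
  | trans _ _ ih₁ ih₂ => exact fun s h => ih₂ s (ih₁ s h)

theorem mul_mem_prodSet_add {G : Type*} [Group G] {S T : Multiset G} {a b : G}
    (ha : a ∈ prodSet S) (hb : b ∈ prodSet T) : a * b ∈ prodSet (S + T) := by
  obtain ⟨l, rfl, rfl⟩ := ha
  obtain ⟨m, rfl, rfl⟩ := hb
  exact ⟨l ++ m, by simp, by simp⟩

theorem prodSet_nonempty {G : Type*} [Group G] (S : Multiset G) : (prodSet S).Nonempty :=
  ⟨S.toList.prod, S.toList, S.coe_toList, rfl⟩

theorem ncard_prodSet_le_card_commutator {G : Type*} [Group G] [Finite G] (S : Multiset G) :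
    (prodSet S).ncard ≤ Nat.card (commutator G) := by
  obtain ⟨a, l, hl, rfl⟩ := prodSet_nonempty S
  rw [← Nat.card_coe_set_eq]
  refine Nat.card_le_card_of_injective
    (fun x : prodSet S => (⟨l.prod⁻¹ * x.1, ?_⟩ : commutator G)) ?_
  · obtain ⟨_, m, hm, rfl⟩ := x
    have h : l.Perm m := Multiset.coe_eq_coe.1 (hl.trans hm.symm)
    rw [← QuotientGroup.eq]
    have key := (h.map (Abelianization.of (G := G))).prod_eq
    rw [← map_list_prod, ← map_list_prod] at key
    exact key
  · intro x y h
    exact Subtype.ext (mul_left_cancel (congrArg Subtype.val h))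

/-- An injection from `A` into a set `B` that is no larger than `A` is onto `B`. -/
theorem exists_eq_of_ncard_le {G : Type*} [Finite G] {A B : Set G} {f : G → G}
    (hf : Function.Injective f) (hAB : ∀ a ∈ A, f a ∈ B) (hcard : B.ncard ≤ A.ncard)
    {b : G} (hb : b ∈ B) : ∃ a ∈ A, f a = b := by
  have h : f '' A = B := Set.eq_of_subset_of_ncard_le (by rintro _ ⟨a, ha, rfl⟩; exact hAB a ha)
    (by rwa [Set.ncard_image_of_injective _ hf]) (Set.toFinite B)
  rw [← h] at hb
  exact hb

/-- In a product-one sequence `S` there is a subsequence `U`, of length bounded in terms of the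
commutator subgroup, such that the remaining terms can be appended in any order to a suitable
ordering of `U` to give product one. -/
theorem IsProductOne.exists_forall_prod_eq_one {G : Type*} [Group G] [Finite G] {S : Multiset G}
    (hS : IsProductOne S) : ∃ U : Multiset G, U ≤ S ∧
      Multiset.card U + 2 ≤ 2 * Nat.card (commutator G) ∧
      ∀ l : List G, U + l = S → ∃ a ∈ prodSet U, a * l.prod = 1 := by
  let F : Set (Multiset G) := {U | U ≤ S ∧ Multiset.card U + 2 ≤ 2 * (prodSet U).ncard ∧
    ∃ l : List G, U + l = S ∧ ∃ a ∈ prodSet U, a * l.prod = 1}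
  have hfin : F.Finite := S.powerset.finite_toSet.subset fun U hU => Multiset.mem_powerset.2 hU.1
  have hne : F.Nonempty := by
    obtain ⟨l, hl, hp⟩ := hS
    refine ⟨0, zero_le, ?_, l, by simpa using hl, 1, ⟨[], rfl, rfl⟩, by simpa using hp⟩
    have := (Set.ncard_pos (Set.toFinite _)).2 (prodSet_nonempty (0 : Multiset G))
    simp only [Multiset.card_zero]
    lia
  obtain ⟨U, ⟨hUS, hUc, l₀, hl₀, hp₀⟩, hmax⟩ := hfin.exists_maximalFor Multiset.card F hne
  have bound : ∀ g h t, U + ((g :: h :: t : List G) : Multiset G) = S →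
      (∃ a ∈ prodSet U, a * (g :: h :: t).prod = 1) →
      (prodSet (U + {g, h})).ncard ≤ (prodSet U).ncard := by
    rintro g h t hs ⟨a, ha, hp⟩
    by_contra! hlt
    have hs' : U + {g, h} + (t : Multiset G) = S := by
      rw [← hs, add_assoc]; rfl
    have hmem : U + {g, h} ∈ F := by
      refine ⟨hs' ▸ Multiset.le_add_right _ _, ?_, t, hs', a * (g * h), ?_, ?_⟩
      · simp only [Multiset.card_add, Multiset.card_pair]; lia
      · exact mul_mem_prodSet_add ha ⟨[g, h], rfl, by simp⟩
      · simpa [mul_assoc] using hp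
    have := hmax hmem (by simp [add_assoc])
    simp at this
  refine ⟨U, hUS, hUc.trans (Nat.mul_le_mul_left 2 (ncard_prodSet_le_card_commutator U)), ?_⟩
  intro l hl
  have hperm : l₀.Perm l := Multiset.coe_eq_coe.1 (add_left_cancel (hl₀.trans hl.symm))
  refine (hperm.of_rotate_of_swap
    (P := fun l => U + (l : Multiset G) = S ∧ ∃ a ∈ prodSet U, a * l.prod = 1)
    ?_ ?_ ⟨hl₀, hp₀⟩).2
  · rintro g (_ | ⟨h, t⟩) ⟨hs, hp⟩
    · exact ⟨hs, hp⟩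
    refine ⟨by rw [← hs]; congr 1; exact Multiset.coe_eq_coe.2 (List.perm_append_singleton _ _), ?_⟩
    have hb := bound g h t hs hp
    obtain ⟨a, ha, hp⟩ := hp
    obtain ⟨a', ha', he⟩ := exists_eq_of_ncard_le (A := prodSet U) (B := prodSet (U + {g, h}))
      (f := fun x => g * x * h) (fun x y hxy => by simpa using hxy)
      (fun x hx => by
        obtain ⟨m, hm, rfl⟩ := hx
        refine ⟨g :: (m ++ [h]), ?_, by simp [mul_assoc]⟩
        rw [← hm, add_comm]
        exact Multiset.coe_eq_coe.2 ((List.perm_append_singleton _ _).cons g)) hb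
      (mul_mem_prodSet_add ha ⟨[g, h], rfl, rfl⟩)
    refine ⟨a', ha', ?_⟩
    have he' : g * a' = a * g := by simpa [← mul_assoc] using he
    have : g * (a' * (h :: t).prod) = 1 := by
      rw [← mul_assoc, he', mul_assoc]; simpa using hp
    rw [List.prod_append, ← mul_assoc, List.prod_singleton]
    exact mul_eq_one_comm.1 this
  · rintro g h t ⟨hs, hp⟩
    refine ⟨by rw [← hs]; congr 1; exact Multiset.coe_eq_coe.2 (List.Perm.swap _ _ _), ?_⟩
    have hb := bound g h t hs hp
    obtain ⟨a, ha, hp⟩ := hp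
    obtain ⟨a', ha', he⟩ := exists_eq_of_ncard_le (A := prodSet U) (B := prodSet (U + {g, h}))
      (f := fun x => x * (h * g)) (mul_left_injective _)
      (fun x hx => mul_mem_prodSet_add hx ⟨[h, g], Multiset.pair_comm _ _, by simp⟩) hb
      (mul_mem_prodSet_add ha ⟨[g, h], rfl, rfl⟩)
    refine ⟨a', ha', ?_⟩
    have he' : a' * (h * g) = a * (g * h) := by simpa using he
    calc a' * (h :: g :: t).prod = a' * (h * g) * t.prod := by simp [mul_assoc]
      _ = a * (g :: h :: t).prod := by rw [he']; simp [mul_assoc]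
      _ = 1 := hp

theorem exists_isProductOne_le_of_card_le {G : Type*} [Group G] [Finite G] {S : Multiset G}
    (hS : Nat.card G ≤ Multiset.card S) : ∃ T ≤ S, T ≠ 0 ∧ IsProductOne T := by
  have : Fintype G := Fintype.ofFinite G
  obtain ⟨l, rfl⟩ := Quot.exists_rep S
  have hS : Fintype.card G ≤ l.length := by rw [← Nat.card_eq_fintype_card]; exact hS
  obtain ⟨i, j, hij, he⟩ := Fintype.exists_ne_map_eq_of_card_lt
    (fun i : Fin (l.length + 1) => (l.take i).prod) (by rw [Fintype.card_fin]; lia)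
  wlog hlt : i < j generalizing i j
  · exact this j i hij.symm he.symm (lt_of_le_of_ne (not_lt.1 hlt) hij.symm)
  refine ⟨((l.drop i).take (j - i) : List G), ?_, ?_, _, rfl, ?_⟩
  · exact Multiset.coe_le.2 (((List.take_sublist _ _).trans (List.drop_sublist _ _)).subperm)
  · rw [ne_eq, ← Multiset.card_eq_zero, Multiset.coe_card, List.length_take, List.length_drop]
    have := j.2
    have : (i : ℕ) < j := hlt
    lia
  · have h : l.take j = l.take i ++ (l.drop i).take (j - i) := by
      rw [← List.take_add]; congr 1; have : (i : ℕ) < j := hlt; lia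
    have he : (l.take i).prod = (l.take j).prod := he
    rw [h, List.prod_append] at he
    exact left_eq_mul.1 he

theorem bddAbove_card_productOneFree (G : Type*) [Group G] [Finite G] :
    BddAbove {n | ∃ S : Multiset G, Multiset.card S = n ∧
      ∀ T : Multiset G, T ≤ S → T ≠ 0 → ¬ IsProductOne T} := by
  refine ⟨Nat.card G, ?_⟩
  rintro _ ⟨S, rfl, hS⟩
  by_contra! h
  obtain ⟨T, hT, h0, h1⟩ := exists_isProductOne_le_of_card_le h.le
  exact hS T hT h0 h1

theorem exists_isProductOne_le_of_smallDavenport_lt {G : Type*} [Group G] [Finite G]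
    {S : Multiset G} (hS : smallDavenport G < Multiset.card S) :
    ∃ T ≤ S, T ≠ 0 ∧ IsProductOne T := by
  by_contra! h
  exact hS.not_ge (le_csSup (bddAbove_card_productOneFree G) ⟨S, rfl, h⟩)

theorem exists_card_eq_smallDavenport (G : Type*) [Group G] [Finite G] :
    ∃ S : Multiset G, Multiset.card S = smallDavenport G ∧
      ∀ T : Multiset G, T ≤ S → T ≠ 0 → ¬ IsProductOne T :=
  Nat.sSup_mem (s := {n | ∃ S : Multiset G, Multiset.card S = n ∧
      ∀ T : Multiset G, T ≤ S → T ≠ 0 → ¬ IsProductOne T})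
    ⟨0, 0, rfl, fun _ hT h0 => absurd (Multiset.le_zero.1 hT) h0⟩
    (bddAbove_card_productOneFree G)

theorem exists_le_card_eq_of_le_card {α : Type*} {S : Multiset α} {n : ℕ}
    (hn : n ≤ Multiset.card S) : ∃ T ≤ S, Multiset.card T = n := by
  refine ⟨(S.toList.take n : List α), ?_, ?_⟩
  · exact (Multiset.coe_le.2 (List.take_sublist _ _).subperm).trans_eq S.coe_toList
  · simpa using hn

theorem IsMinimalProductOne.card_lt {G : Type*} [Group G] [Finite G] {S : Multiset G}
    (hS : IsMinimalProductOne S) (hlen : smallDavenport G + 2 ≤ Multiset.card S) :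
    Multiset.card S + 1 < smallDavenport G + 2 * Nat.card (commutator G) := by
  obtain ⟨U, hU, hUc, hall⟩ := hS.2.1.exists_forall_prod_eq_one
  by_contra! hlong
  obtain ⟨R, rfl⟩ := Multiset.le_iff_exists_add.1 hU
  rw [Multiset.card_add] at hlen hlong
  obtain ⟨R₀, hR₀, hR₀c⟩ := exists_le_card_eq_of_le_card (S := R)
    (n := smallDavenport G + 1) (by lia)
  obtain ⟨T, hT, hT0, m, rfl, hm⟩ := exists_isProductOne_le_of_smallDavenport_lt (S := R₀) (by lia)
  obtain ⟨Q, rfl⟩ := Multiset.le_iff_exists_add.1 (hT.trans hR₀)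
  have hTc := Multiset.card_le_card hT
  rw [Multiset.card_add] at hlen
  obtain ⟨a, ha, hp⟩ := hall (m ++ Q.toList) (by simp [← Multiset.coe_add])
  refine hS.2.2 ⟨m, U + Q, hT0, ?_, by rw [add_left_comm], ⟨m, rfl, hm⟩, ?_⟩
  · rw [ne_eq, ← Multiset.card_eq_zero, Multiset.card_add]
    lia
  · have : a * Q.toList.prod = 1 := by simpa [hm] using hp
    rw [IsProductOne, ← this]
    exact mul_mem_prodSet_add ha ⟨Q.toList, Q.coe_toList, rfl⟩

theorem exists_isMinimalProductOne_card_eq (G : Type*) [Group G] [Finite G] :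
    ∃ S : Multiset G, Multiset.card S = smallDavenport G + 1 ∧ IsMinimalProductOne S := by
  obtain ⟨S, hSc, hS⟩ := exists_card_eq_smallDavenport G
  refine ⟨S.toList.prod⁻¹ ::ₘ S, by simp [hSc], by simp, ?_, ?_⟩
  · exact ⟨S.toList.prod⁻¹ :: S.toList, by rw [← Multiset.cons_coe, S.coe_toList], by simp⟩
  · rintro ⟨T₁, T₂, h₁, h₂, he, hp₁, hp₂⟩
    have hmem : S.toList.prod⁻¹ ∈ T₁ + T₂ := he ▸ Multiset.mem_cons_self _ _
    rcases Multiset.mem_add.1 hmem with h | h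
    · obtain ⟨T, rfl⟩ := Multiset.exists_cons_of_mem h
      rw [Multiset.cons_add, Multiset.cons_inj_right] at he
      exact hS T₂ (he ▸ Multiset.le_add_left _ _) h₂ hp₂
    · obtain ⟨T, rfl⟩ := Multiset.exists_cons_of_mem h
      rw [Multiset.add_cons, Multiset.cons_inj_right] at he
      exact hS T₁ (he ▸ Multiset.le_add_right _ _) h₁ hp₁

theorem card_commutator_eq_one_iff (G : Type*) [Group G] :
    Nat.card (commutator G) = 1 ↔ ∀ a b : G, a * b = b * a := by
  rw [Subgroup.card_eq_one, commutator_eq_bot_iff_center_eq_top, Subgroup.eq_top_iff']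
  simp only [Subgroup.mem_center_iff]
  exact ⟨fun h a b => h b a, fun h a b => h b a⟩

theorem stmt0 (G : Type*) [Group G] [Finite G] :
    largeDavenport G ≤ smallDavenport G + 2 * Nat.card (commutator G) - 1 ∧
    (largeDavenport G = smallDavenport G + 2 * Nat.card (commutator G) - 1 ↔
      ∀ a b : G, a * b = b * a) := by
  have hpos : 0 < Nat.card (commutator G) := Nat.card_pos
  have hupper : ∀ n ∈ {n | ∃ S : Multiset G, Multiset.card S = n ∧ IsMinimalProductOne S},
      n ≤ smallDavenport G + 1 ∨ n + 1 < smallDavenport G + 2 * Nat.card (commutator G) := by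
    rintro _ ⟨S, rfl, hS⟩
    rcases Nat.lt_or_ge (Multiset.card S) (smallDavenport G + 2) with h | h
    · exact Or.inl (by lia)
    · exact Or.inr (hS.card_lt h)
  have hatom := exists_isMinimalProductOne_card_eq G
  have hbdd : BddAbove {n | ∃ S : Multiset G, Multiset.card S = n ∧ IsMinimalProductOne S} :=
    ⟨smallDavenport G + 2 * Nat.card (commutator G), fun n hn => by
      have := hupper n hn
      lia⟩
  have hlower : smallDavenport G + 1 ≤ largeDavenport G := le_csSup hbdd hatom
  have hlarge := hupper _ (Nat.sSup_mem ⟨_, hatom⟩ hbdd)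
  rw [← largeDavenport] at hlarge
  rw [← card_commutator_eq_one_iff G]
  lia
end

section
/- Let G be a finite non-abelian group whose commutator subgroup G' = [G,G] is cyclic of prime order, and let p = min{|G|/|C_G(x)| : x ∈ G \ Z(G)}, where C_G(x) is the centralizer of x and Z(G) is the center. Then D(G) ≤ max( {d(G) + |G'| + ⌊(|G'|−2)/(p−1)⌋} ∪ {D(H) + |G'| + ⌊(|G'|−2)/(p−1)⌋ − 2 : H a proper subgroup of G} ). In particular, if every proper subgroup of G is abelian, then D(G) ≤ d(G) + |G'| + ⌊(|G'|−2)/(p−1)⌋. -/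
section ProductSets

variable {G : Type*} [Group G]

theorem mul_mem_prodSet {S T : Multiset G} {a b : G} (ha : a ∈ prodSet S) (hb : b ∈ prodSet T) :
    a * b ∈ prodSet (S + T) := by
  obtain ⟨l, rfl, rfl⟩ := ha
  obtain ⟨m, rfl, rfl⟩ := hb
  exact ⟨l ++ m, by simp, by simp⟩

theorem one_mem_prodSet_zero : (1 : G) ∈ prodSet (0 : Multiset G) := ⟨[], by simp, by simp⟩

theorem mem_prodSet_singleton (a : G) : a ∈ prodSet ({a} : Multiset G) :=
  ⟨[a], by simp, by simp⟩

theorem exists_mem_prodSet (S : Multiset G) : ∃ a, a ∈ prodSet S :=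
  ⟨S.toList.prod, S.toList, by simp, rfl⟩

theorem abelianization_of_mem_prodSet {S : Multiset G} {a : G} (ha : a ∈ prodSet S) :
    Abelianization.of a = (S.map Abelianization.of).prod := by
  obtain ⟨l, rfl, rfl⟩ := ha
  simp [map_list_prod]

theorem mem_prodSet_map {G' : Type*} [Group G'] (f : G →* G') {S : Multiset G} {a : G}
    (ha : a ∈ prodSet S) : f a ∈ prodSet (S.map f) := by
  obtain ⟨l, rfl, rfl⟩ := ha
  exact ⟨l.map f, by simp, (map_list_prod f l).symm⟩

/-- Replacing a term `y` of a product-one sequence by a sequence having `y` among its products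
gives a product-one sequence. -/
theorem IsProductOne.replace_cons {T V : Multiset G} {y : G} (h : IsProductOne (y ::ₘ V))
    (hy : y ∈ prodSet T) : IsProductOne (T + V) := by
  obtain ⟨l, hl, hl1⟩ := h
  obtain ⟨t, rfl, rfl⟩ := hy
  have hmem : t.prod ∈ l := by
    rw [← Multiset.mem_coe, hl]
    exact Multiset.mem_cons_self _ _
  obtain ⟨l₁, l₂, rfl⟩ := List.append_of_mem hmem
  have hV : V = ((l₁ ++ l₂ : List G) : Multiset G) := by
    have : ((l₁ ++ t.prod :: l₂ : List G) : Multiset G)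
        = t.prod ::ₘ ((l₁ ++ l₂ : List G) : Multiset G) := by
      rw [Multiset.cons_coe, Multiset.coe_eq_coe]
      exact List.perm_middle
    rw [this] at hl
    exact ((Multiset.cons_inj_right _).1 hl).symm
  refine ⟨l₁ ++ t ++ l₂, ?_, by simpa [mul_assoc] using hl1⟩
  rw [hV, ← Multiset.coe_add, ← Multiset.coe_add, ← Multiset.coe_add]
  abel

/-- In a finite group, every long list has a nontrivial proper consecutive sublist with
product one. -/
theorem exists_product_one_sublist [Finite G] {l : List G} (hl : Nat.card G < l.length) :
    ∃ l₁ l₂ l₃ : List G, l = l₁ ++ l₂ ++ l₃ ∧ l₂ ≠ [] ∧ (l₁ ≠ [] ∨ l₃ ≠ []) ∧ l₂.prod = 1 := by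
  cases nonempty_fintype G
  obtain ⟨i, j, hij, h⟩ := Fintype.exists_ne_map_eq_of_card_lt
    (fun i : Fin l.length => (l.take i).prod) (by simpa using hl)
  wlog hlt : i < j generalizing i j
  · exact this j i hij.symm h.symm (lt_of_le_of_ne (not_lt.1 hlt) hij.symm)
  have hlt' : (i : ℕ) < j := hlt
  have hj := j.2
  refine ⟨l.take i, (l.take j).drop i, l.drop j, ?_, ?_, Or.inr ?_, ?_⟩
  · have : l.take i = (l.take j).take i := by
      rw [List.take_take, min_eq_left hlt'.le]
    rw [this, List.take_append_drop, List.take_append_drop]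
  · rw [← List.length_pos_iff]
    simp
    omega
  · rw [← List.length_pos_iff]
    simp
  · have h1 : (l.take j).prod = (l.take i).prod * ((l.take j).drop i).prod := by
      rw [← List.prod_append]
      congr 1
      have : l.take i = (l.take j).take i := by
        rw [List.take_take, min_eq_left hlt'.le]
      rw [this, List.take_append_drop]
    have h' : (l.take i).prod = (l.take j).prod := h
    rw [← h'] at h1
    simpa using h1

theorem card_le_of_isMinimalProductOne [Finite G] {S : Multiset G}
    (hS : IsMinimalProductOne S) : Multiset.card S ≤ Nat.card G := by
  obtain ⟨-, ⟨l, rfl, hl⟩, hmin⟩ := hS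
  by_contra! hlt
  obtain ⟨l₁, l₂, l₃, rfl, h2, h13, hp⟩ := exists_product_one_sublist (l := l) (by simpa using hlt)
  refine hmin ⟨(l₂ : Multiset G), ((l₁ ++ l₃ : List G) : Multiset G), by simpa using h2, ?_, ?_,
    ⟨l₂, rfl, hp⟩, ⟨l₁ ++ l₃, rfl, ?_⟩⟩
  · rw [Ne, Multiset.coe_eq_zero, List.append_eq_nil_iff]
    tauto
  · simp only [← Multiset.coe_add]
    abel
  · simpa [hp] using hl

theorem card_le_of_product_one_free [Finite G] {S : Multiset G}
    (hS : ∀ T : Multiset G, T ≤ S → T ≠ 0 → ¬ IsProductOne T) :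
    Multiset.card S ≤ Nat.card G := by
  by_contra! hlt
  induction S using Quotient.inductionOn with | _ l => ?_
  obtain ⟨l₁, l₂, l₃, rfl, h2, -, hp⟩ := exists_product_one_sublist (l := l) (by simpa using hlt)
  refine hS (l₂ : Multiset G) ?_ (by simpa using h2) ⟨l₂, rfl, hp⟩
  change (l₂ : Multiset G) ≤ ((l₁ ++ l₂ ++ l₃ : List G) : Multiset G)
  rw [Multiset.coe_le]
  exact ((List.sublist_append_right l₁ l₂).trans (List.sublist_append_left _ l₃)).subperm

theorem exists_product_one_of_smallDavenport_lt [Finite G] {S : Multiset G}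
    (hS : smallDavenport G < Multiset.card S) : ∃ T ≤ S, T ≠ 0 ∧ IsProductOne T := by
  by_contra! h
  refine hS.not_ge (le_csSup ⟨Nat.card G, ?_⟩ ⟨S, rfl, h⟩)
  rintro _ ⟨T, rfl, hT⟩
  exact card_le_of_product_one_free hT

theorem card_le_largeDavenport [Finite G] {S : Multiset G}
    (hS : IsMinimalProductOne S) : Multiset.card S ≤ largeDavenport G := by
  refine le_csSup ⟨Nat.card G, ?_⟩ ⟨S, rfl, hS⟩
  rintro _ ⟨T, rfl, hT⟩
  exact card_le_of_isMinimalProductOne hT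

theorem exists_card_eq_largeDavenport [Finite G] :
    ∃ S : Multiset G, Multiset.card S = largeDavenport G ∧ IsMinimalProductOne S := by
  refine Nat.sSup_mem (s := {n | ∃ S : Multiset G, Multiset.card S = n ∧ IsMinimalProductOne S})
    ⟨1, {1}, by simp, by simp, mem_prodSet_singleton 1, ?_⟩ ⟨Nat.card G, ?_⟩
  · rintro ⟨T₁, T₂, h₁, h₂, h, -⟩
    have := congrArg Multiset.card h
    have h1 := Multiset.card_pos.2 h₁
    have h2 := Multiset.card_pos.2 h₂
    simp at this
    omega
  · rintro _ ⟨T, rfl, hT⟩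
    exact card_le_of_isMinimalProductOne hT

/-- If `X` commutes as a set with the elements satisfying `P`, then the first term violating `P`
can be moved next to `X` without changing the total product. -/
theorem exists_rotation_of_not {X : Finset G} {P : G → Prop}
    (hP : ∀ r, P r → ∀ x ∈ X, r⁻¹ * x * r ∈ X) {l : List G} (hl : ∃ r ∈ l, ¬ P r)
    {y : G} (hy : y ∈ X) (h1 : y * l.prod = 1) :
    ∃ r, ∃ m : List G, ¬ P r ∧ (l : Multiset G) = r ::ₘ (m : Multiset G) ∧
      ∃ z ∈ X, z * (r * m.prod) = 1 := by
  classical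
  induction hn : l.findIdx (fun r => ¬ P r) generalizing l y with
  | zero =>
    match l, hl with
    | r :: m, _ =>
      have : ¬ P r := by
        rw [List.findIdx_cons] at hn
        by_contra h
        simp [h] at hn
      exact ⟨r, m, this, rfl, y, hy, by simpa using h1⟩
  | succ n ih =>
    match l, hl with
    | r :: m, hl =>
      rw [List.findIdx_cons] at hn
      have hr : P r := by
        by_contra h
        simp [h] at hn
      obtain ⟨s, hs, hPs⟩ := hl
      have hsm : s ∈ m := by
        rcases List.mem_cons.1 hs with rfl | h
        · exact absurd hr hPs
        · exact h
      have hlt : m.findIdx (fun r => ¬ P r) < m.length :=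
        List.findIdx_lt_length_of_exists ⟨s, hsm, by simpa using hPs⟩
      obtain ⟨r', m', h, h', h''⟩ := ih (l := m ++ [r]) (y := r⁻¹ * y * r) ⟨s, by simp [hsm], hPs⟩
        (hP r hr y hy) (by
          have : r⁻¹ * (y * (r :: m).prod) * r = 1 := by rw [h1]; simp
          simpa [mul_assoc] using this) (by
          rw [List.findIdx_append, if_pos hlt]
          simpa [hr] using hn)
      refine ⟨r', m', h, ?_, h''⟩
      rw [← h', Multiset.coe_eq_coe]
      exact (List.perm_append_singleton r m).symm

end ProductSets

section Sumsets

variable {G : Type*} [Group G]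

open scoped Pointwise in
/-- The Cauchy-Davenport inequality for subsets of a left and a right coset of a subgroup of
prime order. -/
theorem cauchy_davenport_coset [DecidableEq G] {N : Subgroup G} (hN : (Nat.card N).Prime)
    {X Y : Finset G} {x y : G} (hx : x ∈ X) (hy : y ∈ Y) (hX : ∀ z ∈ X, x⁻¹ * z ∈ N)
    (hY : ∀ z ∈ Y, z * y⁻¹ ∈ N) :
    min (Nat.card N) (X.card + Y.card - 1) ≤ (X * Y).card := by
  have : Finite N := Nat.finite_of_card_ne_zero hN.ne_zero
  let A : Finset N := X.attach.image fun z => ⟨x⁻¹ * z.1, hX z.1 z.2⟩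
  let B : Finset N := Y.attach.image fun z => ⟨z.1 * y⁻¹, hY z.1 z.2⟩
  have hA : A.card = X.card := by
    rw [Finset.card_image_of_injective, Finset.card_attach]
    intro a b h
    exact Subtype.ext (mul_left_cancel (congrArg Subtype.val h))
  have hB : B.card = Y.card := by
    rw [Finset.card_image_of_injective, Finset.card_attach]
    intro a b h
    exact Subtype.ext (mul_right_cancel (congrArg Subtype.val h))
  have hAB : (A * B).card ≤ (X * Y).card := by
    refine Finset.card_le_card_of_injOn (fun c : N => x * c * y) ?_ ?_
    · intro c hc
      obtain ⟨a, ha, b, hb, rfl⟩ := Finset.mem_mul.1 (Finset.mem_coe.1 hc)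
      obtain ⟨⟨a, ha'⟩, -, rfl⟩ := Finset.mem_image.1 ha
      obtain ⟨⟨b, hb'⟩, -, rfl⟩ := Finset.mem_image.1 hb
      have : x * (x⁻¹ * a * (b * y⁻¹)) * y = a * b := by group
      change x * (x⁻¹ * a * (b * y⁻¹)) * y ∈ ((X * Y : Finset G) : Set G)
      rw [this]
      exact Finset.mul_mem_mul ha' hb'
    · intro c _ d _ h
      exact Subtype.ext (mul_left_cancel (mul_right_cancel h))
  have hcd := cauchy_davenport_minOrder_mul (s := A) (t := B)
    (Finset.card_pos.1 (hA ▸ Finset.card_pos.2 ⟨x, hx⟩))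
    (Finset.card_pos.1 (hB ▸ Finset.card_pos.2 ⟨y, hy⟩))
  have hmin : (Nat.card N : ℕ∞) ≤ Monoid.minOrder N := by
    rw [Monoid.le_minOrder]
    intro a ha _
    have := (Nat.dvd_prime hN).1 (orderOf_dvd_natCard a)
    rcases this with h | h
    · exact absurd (orderOf_eq_one_iff.1 h) ha
    · rw [h]
  rw [hA, hB] at hcd
  have h2 : min (Nat.card N : ℕ∞) ((X.card + Y.card - 1 : ℕ) : ℕ∞) ≤ (A * B).card :=
    le_trans (min_le_min hmin le_rfl) hcd
  refine le_trans ?_ hAB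
  rw [min_le_iff] at h2 ⊢
  simpa only [Nat.cast_le] using h2

theorem inv_mul_mem_commutator {S : Multiset G} {a b : G} (ha : a ∈ prodSet S)
    (hb : b ∈ prodSet S) : a⁻¹ * b ∈ commutator G := by
  rw [← Abelianization.ker_of, MonoidHom.mem_ker, map_mul, map_inv,
    abelianization_of_mem_prodSet ha, abelianization_of_mem_prodSet hb, inv_mul_cancel]

theorem mul_inv_mem_commutator {S : Multiset G} {a b : G} (ha : a ∈ prodSet S)
    (hb : b ∈ prodSet S) : b * a⁻¹ ∈ commutator G := by
  rw [← Abelianization.ker_of, MonoidHom.mem_ker, map_mul, map_inv,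
    abelianization_of_mem_prodSet ha, abelianization_of_mem_prodSet hb, mul_inv_cancel]

/-- A set of products at least as large as the commutator subgroup is a full
coset of it. -/
theorem mem_of_card_commutator_le [Finite G] {X : Finset G} {T : Multiset G}
    (hX : (X : Set G) ⊆ prodSet T) (hcard : Nat.card (commutator G) ≤ X.card) {x z : G}
    (hx : x ∈ X) (hz : x⁻¹ * z ∈ commutator G) : z ∈ X := by
  have hsub : (fun w => x⁻¹ * w) '' (X : Set G) ⊆ (commutator G : Set G) := by
    rintro _ ⟨w, hw, rfl⟩
    exact inv_mul_mem_commutator (hX hx) (hX hw)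
  have heq := Set.eq_of_subset_of_ncard_le hsub (by
    rw [Set.ncard_image_of_injective _ (mul_right_injective _), Set.ncard_coe_finset]
    exact hcard) (Set.toFinite _)
  have : x⁻¹ * z ∈ (fun w => x⁻¹ * w) '' (X : Set G) := by
    rw [heq]
    exact hz
  obtain ⟨w, hw, h⟩ := this
  rwa [← mul_left_cancel h]

/-- A conjugation-invariant set containing `x` has at least as many elements as the conjugacy
class of `x`. -/
theorem card_div_card_centralizer_le [Finite G] {X : Finset G}
    (hX : ∀ g : G, ∀ x ∈ X, g⁻¹ * x * g ∈ X) {x : G} (hx : x ∈ X) :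
    Nat.card G / Nat.card (Subgroup.centralizer ({x} : Set G)) ≤ X.card := by
  have hindex : Nat.card G / Nat.card (Subgroup.centralizer ({x} : Set G))
      = (Subgroup.centralizer ({x} : Set G)).index := by
    rw [← Subgroup.card_mul_index (Subgroup.centralizer ({x} : Set G)),
      Nat.mul_div_cancel_left _ Nat.card_pos]
  have hcard : X.card = Nat.card (X : Set G) := by simp
  rw [hindex, Subgroup.index, hcard]
  refine Nat.card_le_card_of_injective
    (fun c : G ⧸ Subgroup.centralizer ({x} : Set G) =>
      (⟨c.out * x * c.out⁻¹, by simpa using hX c.out⁻¹ x hx⟩ : (X : Set G))) ?_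
  intro c d h
  have h : c.out * x * c.out⁻¹ = d.out * x * d.out⁻¹ := by simpa [Subtype.ext_iff] using h
  rw [← QuotientGroup.out_eq' c, ← QuotientGroup.out_eq' d, QuotientGroup.eq,
    Subgroup.mem_centralizer_singleton_iff]
  have h' : c.out⁻¹ * (c.out * x * c.out⁻¹) * d.out = c.out⁻¹ * (d.out * x * d.out⁻¹) * d.out := by
    rw [h]
  simp only [mul_assoc, inv_mul_cancel_left, inv_mul_cancel, mul_one] at h' ⊢
  exact h'.symm

end Sumsets

section Atoms

variable {G : Type*} [Group G]

/-- If `T` can be multiplied out to an element `y` making `y` times the rest a long product-one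
sequence over a subgroup, the whole sequence is not minimal. -/
theorem IsMinimalProductOne.card_lt_largeDavenport [Finite G] {T R : Multiset G}
    (hS : IsMinimalProductOne (T + R)) (hT : T ≠ 0) {H : Subgroup G} (hR : ∀ r ∈ R, r ∈ H)
    {y : G} (hy : y ∈ prodSet T) {l : List G} (hl : (l : Multiset G) = R) (h1 : y * l.prod = 1) :
    Multiset.card R + 1 ≤ largeDavenport H := by
  subst hl
  have hlH : l.prod ∈ H := Subgroup.list_prod_mem H hR
  have hyH : y ∈ H := by
    rw [eq_inv_of_mul_eq_one_left h1]
    exact H.inv_mem hlH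
  lift y to H using hyH
  lift l to List H using hR
  have hmin : IsMinimalProductOne (y ::ₘ (l : Multiset H)) := by
    refine ⟨Multiset.cons_ne_zero, ⟨y :: l, rfl, ?_⟩, ?_⟩
    · have : (l.map ((↑) : H → G)).prod = (l.prod : H) := (map_list_prod H.subtype l).symm
      rw [this] at h1
      exact_mod_cast h1
    · rintro ⟨T₁, T₂, hT₁, hT₂, h, h₁, h₂⟩
      wlog hmem : y ∈ T₁ generalizing T₁ T₂
      · refine this T₂ T₁ hT₂ hT₁ (h.trans (add_comm _ _)) h₂ h₁ ?_
        have : y ∈ T₁ + T₂ := h ▸ Multiset.mem_cons_self _ _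
        exact (Multiset.mem_add.1 this).resolve_left hmem
      obtain ⟨V, rfl⟩ := Multiset.exists_cons_of_mem hmem
      rw [Multiset.cons_add, Multiset.cons_inj_right] at h
      have hmap := mem_prodSet_map H.subtype h₁
      rw [map_one, Multiset.map_cons] at hmap
      have hmap₂ := mem_prodSet_map H.subtype h₂
      rw [map_one] at hmap₂
      refine hS.2.2 ⟨T + V.map H.subtype, T₂.map H.subtype, ?_, ?_, ?_,
        IsProductOne.replace_cons hmap hy, hmap₂⟩
      · exact fun h0 => hT (add_eq_zero.1 h0).1
      · simpa using hT₂
      · rw [add_assoc, ← Multiset.map_add, ← h]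
        simp
  have := card_le_largeDavenport hmin
  simpa using this

/-- If the products of `T` contain a full coset of the commutator subgroup, the rest of a minimal
product-one sequence has no nontrivial product-one subsequence. -/
theorem IsMinimalProductOne.card_le_smallDavenport [Finite G] {T R : Multiset G}
    (hS : IsMinimalProductOne (T + R)) (hT : T ≠ 0) {X : Finset G}
    (hX : (X : Set G) ⊆ prodSet T) (hcard : Nat.card (commutator G) ≤ X.card) :
    Multiset.card R ≤ smallDavenport G := by
  by_contra! hlt
  obtain ⟨P, hPR, hP0, hP⟩ := exists_product_one_of_smallDavenport_lt hlt
  obtain ⟨Q, rfl⟩ := Multiset.le_iff_exists_add.1 hPR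
  obtain ⟨x, hx⟩ : X.Nonempty := Finset.card_pos.1 (lt_of_lt_of_le Nat.card_pos hcard)
  obtain ⟨r, hr⟩ := exists_mem_prodSet Q
  have hinv : r⁻¹ ∈ X := by
    refine mem_of_card_commutator_le hX hcard hx ?_
    have h := inv_mul_mem_commutator
      (mul_mem_prodSet (hX hx) (mul_mem_prodSet hP hr)) hS.2.1
    have hn : (commutator G).Normal := inferInstance
    have h' := hn.conj_mem _ h r
    simpa [mul_assoc] using hn.mem_comm (by simpa [mul_assoc] using h)
  refine hS.2.2 ⟨P, T + Q, hP0, fun h0 => hT (add_eq_zero.1 h0).1, by abel, hP, ?_⟩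
  have := mul_mem_prodSet (hX hinv) hr
  rwa [inv_mul_cancel] at this

theorem conj_mem_of_closure_eq_top {X : Finset G} {R : Set G} (hR : Subgroup.closure R = ⊤)
    (hX : ∀ r ∈ R, ∀ x ∈ X, r⁻¹ * x * r ∈ X) (g : G) : ∀ x ∈ X, g⁻¹ * x * g ∈ X := by
  classical
  have hg : g ∈ Subgroup.closure R := hR ▸ Subgroup.mem_top g
  induction hg using Subgroup.closure_induction with
  | mem r hr => exact hX r hr
  | one => simp
  | mul a b _ _ ha hb =>
    intro x hx
    have := hb _ (ha x hx)
    simpa [mul_assoc] using this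
  | inv a _ ha =>
    intro x hx
    have himg : X.image (fun z => a⁻¹ * z * a) = X := by
      refine Finset.eq_of_subset_of_card_le ?_ ?_
      · intro z hz
        obtain ⟨w, hw, rfl⟩ := Finset.mem_image.1 hz
        exact ha w hw
      · rw [Finset.card_image_of_injective]
        intro z w h
        simpa using h
    rw [← himg] at hx
    obtain ⟨w, hw, rfl⟩ := Finset.mem_image.1 hx
    simpa [mul_assoc] using hw

open scoped Pointwise in
/-- The growth argument: `X₀` is a conjugation-invariant set of products of the finished blocks
`T₀`, and `X₁` is a set of products of the current block `T₁`. -/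
theorem IsMinimalProductOne.false_of_blocks [Finite G] [DecidableEq G]
    (hna : ¬ ∀ a b : G, a * b = b * a) (hprime : (Nat.card (commutator G)).Prime) {p : ℕ}
    (hp2 : 2 ≤ p) (hp : ∀ x : G, x ∉ Subgroup.center G →
      p ≤ Nat.card G / Nat.card (Subgroup.centralizer ({x} : Set G)))
    {S : Multiset G} (hS : IsMinimalProductOne S)
    (hd : smallDavenport G + Nat.card (commutator G) +
        (Nat.card (commutator G) - 2) / (p - 1) < Multiset.card S)
    (hD : ∀ H : Subgroup G, H ≠ ⊤ → largeDavenport H +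
        Nat.card (commutator G) + (Nat.card (commutator G) - 2) / (p - 1) - 2 < Multiset.card S)
    {T₀ T₁ R : Multiset G} (hsum : S = T₀ + T₁ + R) {X₀ X₁ : Finset G}
    (hX₀ : (X₀ : Set G) ⊆ prodSet T₀) (hX₁ : (X₁ : Set G) ⊆ prodSet T₁)
    (hconj : ∀ g : G, ∀ x ∈ X₀, g⁻¹ * x * g ∈ X₀) {k s : ℕ} (hk : k ≤ X₀.card)
    (hs : s * (p - 1) + 1 ≤ k) (hT₀ : Multiset.card T₀ + 1 ≤ k + s)
    (hT₁ : Multiset.card T₁ ≤ X₁.card) (hT₁0 : T₁ ≠ 0)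
    (hnc : ∃ x ∈ X₁, x ∉ Subgroup.center G)
    (hlt : k + X₁.card ≤ Nat.card (commutator G))
    (hone : ∃ y ∈ X₀ * X₁, ∃ l : List G, (l : Multiset G) = R ∧ y * l.prod = 1) : False := by
  induction hn : Multiset.card R generalizing T₀ T₁ R X₀ X₁ k s with
  | zero =>
    have := hprime.two_le
    have hsF : s ≤ (Nat.card (commutator G) - 2) / (p - 1) := by
      rw [Nat.le_div_iff_mul_le (by omega)]
      have : 0 < X₁.card := Finset.card_pos.2 ⟨_, hnc.choose_spec.1⟩
      omega
    have : Multiset.card S = Multiset.card T₀ + Multiset.card T₁ + Multiset.card R := by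
      rw [hsum, Multiset.card_add, Multiset.card_add]
    omega
  | succ n ih =>
    have hq := hprime.two_le
    have hcardS : Multiset.card S = Multiset.card T₀ + Multiset.card T₁ + Multiset.card R := by
      rw [hsum, Multiset.card_add, Multiset.card_add]
    have hX₁pos : 0 < X₁.card := Finset.card_pos.2 ⟨_, hnc.choose_spec.1⟩
    have hsF : s ≤ (Nat.card (commutator G) - 2) / (p - 1) := by
      rw [Nat.le_div_iff_mul_le (by omega)]
      omega
    obtain ⟨y, hy, l, rfl, hyl⟩ := hone
    have hX₀₁ : ((X₀ * X₁ : Finset G) : Set G) ⊆ prodSet (T₀ + T₁) := by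
      intro z hz
      obtain ⟨a, ha, b, hb, rfl⟩ := Finset.mem_mul.1 (Finset.mem_coe.1 hz)
      exact mul_mem_prodSet (hX₀ ha) (hX₁ hb)
    have hconj₀₁ : ∀ g : G, (∀ x ∈ X₁, g⁻¹ * x * g ∈ X₁) →
        ∀ x ∈ X₀ * X₁, g⁻¹ * x * g ∈ X₀ * X₁ := by
      intro g hg x hx
      obtain ⟨a, ha, b, hb, rfl⟩ := Finset.mem_mul.1 hx
      have : g⁻¹ * (a * b) * g = (g⁻¹ * a * g) * (g⁻¹ * b * g) := by group
      rw [this]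
      exact Finset.mul_mem_mul (hconj g a ha) (hg b hb)
    have hT₀₁ : T₀ + T₁ ≠ 0 := fun h0 => hT₁0 (add_eq_zero.1 h0).2
    obtain ⟨a₀, ha₀⟩ : X₀.Nonempty := Finset.card_pos.1 (by omega)
    by_cases hstuck : ∃ r ∈ l, ¬ ∀ x ∈ X₁, r⁻¹ * x * r ∈ X₁
    · obtain ⟨r, m, hr, hlm, z, hz, hzm⟩ := exists_rotation_of_not hconj₀₁ hstuck hy hyl
      let X₂ : Finset G := X₁.image (fun x => x * r) ∪ X₁.image (fun x => r * x)
      push Not at hr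
      obtain ⟨x, hx, hxr⟩ := hr
      have hx₂ : x * r ∈ X₂ :=
        Finset.mem_union_left _ (Finset.mem_image_of_mem (fun x => x * r) hx)
      have hcard₂ : X₁.card + 1 ≤ X₂.card := by
        have hnot : x * r ∉ X₁.image (fun x => r * x) := by
          intro h
          obtain ⟨w, hw, hwr⟩ := Finset.mem_image.1 h
          refine hxr ?_
          have : r⁻¹ * x * r = w := by rw [mul_assoc, ← hwr, inv_mul_cancel_left]
          rwa [this]
        rw [← Finset.card_image_of_injective X₁ (mul_right_injective r),
          ← Finset.card_insert_of_notMem hnot]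
        exact Finset.card_le_card (Finset.insert_subset hx₂ Finset.subset_union_right)
      have hX₂ : (X₂ : Set G) ⊆ prodSet (T₁ + {r}) := by
        intro w hw
        rcases Finset.mem_union.1 (Finset.mem_coe.1 hw) with h | h
        · obtain ⟨v, hv, rfl⟩ := Finset.mem_image.1 h
          exact mul_mem_prodSet (hX₁ hv) (mem_prodSet_singleton r)
        · obtain ⟨v, hv, rfl⟩ := Finset.mem_image.1 h
          rw [add_comm]
          exact mul_mem_prodSet (mem_prodSet_singleton r) (hX₁ hv)
      have hsum₂ : S = T₀ + (T₁ + {r}) + (m : Multiset G) := by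
        rw [hsum, hlm, ← Multiset.singleton_add]
        abel
      have hcardm : Multiset.card (m : Multiset G) = n := by
        rw [hlm, Multiset.card_cons] at hn
        omega
      by_cases hfull : k + X₂.card ≤ Nat.card (commutator G)
      · refine ih (T₁ := T₁ + {r}) (R := (m : Multiset G)) hsum₂ hX₀ hX₂ hconj hk hs hT₀
          ?_ ?_ ⟨x * r, hx₂, ?_⟩ hfull ?_ hcardm
        · rw [Multiset.card_add, Multiset.card_singleton]
          omega
        · exact fun h0 => hT₁0 (add_eq_zero.1 h0).1
        · intro hc
          have hcomm := Subgroup.mem_center_iff.1 hc x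
          rw [mul_assoc] at hcomm
          have : r⁻¹ * x * r = x := by
            rw [mul_assoc, mul_left_cancel hcomm, inv_mul_cancel_left]
          exact hxr (this.symm ▸ hx)
        · obtain ⟨a, ha, b, hb, rfl⟩ := Finset.mem_mul.1 hz
          refine ⟨a * (b * r), Finset.mul_mem_mul ha (Finset.mem_union_left _
            (Finset.mem_image_of_mem (fun x => x * r) hb)), m, rfl, ?_⟩
          rw [← hzm]
          group
      · have hcd := cauchy_davenport_coset hprime ha₀ hx₂
          (fun w hw => inv_mul_mem_commutator (hX₀ ha₀) (hX₀ hw))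
          (fun w hw => mul_inv_mem_commutator (hX₂ hx₂) (hX₂ hw))
        rw [min_eq_left (by omega)] at hcd
        have hsub : ((X₀ * X₂ : Finset G) : Set G) ⊆ prodSet (T₀ + (T₁ + {r})) := by
          intro z hz
          obtain ⟨a, ha, b, hb, rfl⟩ := Finset.mem_mul.1 (Finset.mem_coe.1 hz)
          exact mul_mem_prodSet (hX₀ ha) (hX₂ hb)
        have := (hsum₂ ▸ hS).card_le_smallDavenport
          (fun h0 => hT₁0 (add_eq_zero.1 (add_eq_zero.1 h0).2).1) hsub hcd
        omega
    · push Not at hstuck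
      by_cases hcl : Subgroup.closure {r | r ∈ l} = ⊤
      · have hconj₁ := conj_mem_of_closure_eq_top hcl hstuck
        obtain ⟨x, hx, hxc⟩ := hnc
        have hpX : p ≤ X₁.card := (hp x hxc).trans (card_div_card_centralizer_le hconj₁ hx)
        have hr : ∃ r ∈ l, ¬ r ∈ Subgroup.center G := by
          by_contra! h
          have : Subgroup.closure {r | r ∈ l} ≤ Subgroup.center G :=
            (Subgroup.closure_le _).2 h
          rw [hcl] at this
          exact hna fun a b => (Subgroup.mem_center_iff.1 (this (Subgroup.mem_top a)) b).symm
        obtain ⟨r, m, hr, hlm, z, hz, hzm⟩ := exists_rotation_of_not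
          (P := fun r => r ∈ Subgroup.center G)
          (fun g _ => hconj₀₁ g (hconj₁ g)) hr hy hyl
        have hcd := cauchy_davenport_coset hprime ha₀ hx
          (fun w hw => inv_mul_mem_commutator (hX₀ ha₀) (hX₀ hw))
          (fun w hw => mul_inv_mem_commutator (hX₁ hx) (hX₁ hw))
        refine ih (T₀ := T₀ + T₁) (T₁ := {r}) (R := (m : Multiset G)) (X₀ := X₀ * X₁) (X₁ := {r})
          (k := k + X₁.card - 1) (s := s + 1) ?_ hX₀₁ ?_ (fun g => hconj₀₁ g (hconj₁ g)) ?_ ?_ ?_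
          ?_ ?_ ⟨r, by simp, hr⟩ ?_ ?_ ?_
        · rw [hsum, hlm, ← Multiset.singleton_add, ← add_assoc]
        · simpa using mem_prodSet_singleton r
        · refine le_trans ?_ hcd
          rw [le_min_iff]
          omega
        · rw [add_mul]
          omega
        · rw [Multiset.card_add]
          omega
        · simp
        · simp
        · rw [Finset.card_singleton]
          omega
        · exact ⟨z * r, Finset.mul_mem_mul hz (by simp), m, rfl, by rw [← hzm, mul_assoc]⟩
        · rw [hlm, Multiset.card_cons] at hn
          omega
      · have h1 := (hsum ▸ hS).card_lt_largeDavenport hT₀₁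
          (H := Subgroup.closure {r | r ∈ l}) (fun r hr => Subgroup.subset_closure hr)
          (hX₀₁ hy) rfl hyl
        have h2 := hD _ hcl
        omega

theorem largeDavenport_le_smallDavenport_add_one [Finite G] {H : Subgroup G}
    (hH : ∀ a b : H, a * b = b * a) : largeDavenport H ≤ smallDavenport G + 1 := by
  obtain ⟨U, hU, hU0, ⟨l, rfl, hl⟩, hmin⟩ := exists_card_eq_largeDavenport (G := H)
  obtain ⟨a, m, rfl⟩ := List.exists_cons_of_ne_nil (show l ≠ [] by simpa using hU0)
  rw [← hU]
  by_contra! hlt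
  have hlt' : smallDavenport G < Multiset.card ((m : Multiset H).map H.subtype) := by
    simpa using hlt
  obtain ⟨T, hT, hT0, hT1⟩ := exists_product_one_of_smallDavenport_lt hlt'
  have hTH : ∀ t ∈ T, t ∈ H := by
    intro t ht
    obtain ⟨u, -, rfl⟩ := Multiset.mem_map.1 (Multiset.mem_of_le hT ht)
    exact u.2
  lift T to Multiset H using hTH
  have hTm : T ≤ (m : Multiset H) := (Multiset.map_le_map_iff Subtype.val_injective).1 hT
  obtain ⟨V, hV⟩ := Multiset.le_iff_exists_add.1 hTm
  let _ : CommGroup H := { mul_comm := hH }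
  have prod_eq : ∀ {W : Multiset H} {w : H}, w ∈ prodSet W → w = W.prod := by
    rintro _ _ ⟨t, rfl, rfl⟩
    simp
  have hT1' : (1 : H) ∈ prodSet T := by
    obtain ⟨t, ht, ht1⟩ := hT1
    have htH : ∀ u ∈ t, u ∈ H := by
      intro u hu
      have : u ∈ (t : Multiset G) := hu
      rw [ht] at this
      obtain ⟨v, -, rfl⟩ := Multiset.mem_map.1 this
      exact v.2
    lift t to List H using htH
    refine ⟨t, ?_, ?_⟩
    · exact Multiset.map_injective Subtype.val_injective (by simpa using ht)
    · have : (t.map ((↑) : H → G)).prod = (t.prod : H) := (map_list_prod H.subtype t).symm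
      rw [this] at ht1
      exact_mod_cast ht1
  refine hmin ⟨a ::ₘ V, T, Multiset.cons_ne_zero, by simpa using hT0, ?_, ?_, hT1'⟩
  · rw [← Multiset.cons_coe, hV, Multiset.cons_add, add_comm]
  · obtain ⟨w, hw⟩ := exists_mem_prodSet (a ::ₘ V)
    have h1 : (1 : H) = w := by
      rw [prod_eq hw, ← hl, ← Multiset.prod_coe, ← Multiset.cons_coe, hV,
        Multiset.prod_cons, Multiset.prod_cons, Multiset.prod_add, ← prod_eq hT1', one_mul]
    change (1 : H) ∈ prodSet (a ::ₘ V)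
    rwa [h1]

end Atoms

theorem stmt1 (G : Type*) [Group G] [Finite G]
    (hna : ¬ ∀ a b : G, a * b = b * a)
    (hcyc : IsCyclic (commutator G)) (hprime : (Nat.card (commutator G)).Prime)
    (p : ℕ)
    (hp : IsLeast {n | ∃ x : G, x ∉ Subgroup.center G ∧
      n = Nat.card G / Nat.card (Subgroup.centralizer ({x} : Set G))} p) :
    (largeDavenport G ≤ smallDavenport G + Nat.card (commutator G) +
        (Nat.card (commutator G) - 2) / (p - 1) ∨
      ∃ H : Subgroup G, H ≠ ⊤ ∧ largeDavenport G ≤ largeDavenport H +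
        Nat.card (commutator G) + (Nat.card (commutator G) - 2) / (p - 1) - 2) ∧
    ((∀ H : Subgroup G, H ≠ ⊤ → ∀ a b : H, a * b = b * a) →
      largeDavenport G ≤ smallDavenport G + Nat.card (commutator G) +
        (Nat.card (commutator G) - 2) / (p - 1)) := by
  classical
  have hq := hprime.two_le
  have hp2 : 2 ≤ p := by
    obtain ⟨x, hx, rfl⟩ := hp.1
    rw [← Subgroup.card_mul_index (Subgroup.centralizer ({x} : Set G)),
      Nat.mul_div_cancel_left _ Nat.card_pos]
    have h0 : (Subgroup.centralizer ({x} : Set G)).index ≠ 0 := Subgroup.index_ne_zero_of_finite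
    have h1 : (Subgroup.centralizer ({x} : Set G)).index ≠ 1 := by
      rw [Ne, Subgroup.index_eq_one]
      intro h
      refine hx (Subgroup.mem_center_iff.2 fun g => ?_)
      exact Subgroup.mem_centralizer_singleton_iff.1 (h ▸ Subgroup.mem_top g)
    omega
  have hmain : largeDavenport G ≤ smallDavenport G + Nat.card (commutator G) +
        (Nat.card (commutator G) - 2) / (p - 1) ∨
      ∃ H : Subgroup G, H ≠ ⊤ ∧ largeDavenport G ≤ largeDavenport H +
        Nat.card (commutator G) + (Nat.card (commutator G) - 2) / (p - 1) - 2 := by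
    by_contra! hcon
    obtain ⟨hd, hD⟩ := hcon
    obtain ⟨S, hcard, hS⟩ := exists_card_eq_largeDavenport (G := G)
    rw [← hcard] at hd hD
    obtain ⟨hS0, ⟨l, rfl, hl⟩, -⟩ := id hS
    by_cases hcen : ∃ r ∈ l, ¬ r ∈ Subgroup.center G
    · obtain ⟨r, m, hr, hlm, z, hz, hzm⟩ := exists_rotation_of_not (X := {1})
        (P := fun r => r ∈ Subgroup.center G) (by simp) hcen (Finset.mem_singleton_self 1)
        (by simpa using hl)
      rw [Finset.mem_singleton] at hz
      refine hS.false_of_blocks hna hprime hp2 (fun x hx => hp.2 ⟨x, hx, rfl⟩) hd hD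
        (T₀ := 0) (T₁ := {r}) (R := (m : Multiset G)) (X₀ := {1}) (X₁ := {r}) (k := 1) (s := 0)
        (by simp [hlm]) (by simpa using one_mem_prodSet_zero)
        (by simpa using mem_prodSet_singleton r) (by simp) (by simp) (by simp) (by simp)
        (by simp) (by simp) ⟨r, by simp, hr⟩ (by simpa using hq)
        ⟨r, by simp, m, rfl, by simpa [hz] using hzm⟩
    · push Not at hcen
      have hne : Subgroup.center G ≠ ⊤ := by
        intro h
        exact hna fun a b => (Subgroup.mem_center_iff.1 (h ▸ Subgroup.mem_top a) b).symm
      obtain ⟨a, m, rfl⟩ := List.exists_cons_of_ne_nil (show l ≠ [] by simpa using hS0)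
      have h1 := IsMinimalProductOne.card_lt_largeDavenport (T := {a}) (R := (m : Multiset G))
        (by simpa using hS) (by simp) (H := Subgroup.center G)
        (fun r hr => hcen r (List.mem_cons_of_mem _ hr)) (mem_prodSet_singleton a) rfl
        (by simpa using hl)
      have h2 := hD _ hne
      simp only [Multiset.coe_card, List.length_cons] at h1 h2
      generalize (Nat.card (commutator G) - 2) / (p - 1) = F at h2
      omega
  refine ⟨hmain, fun hab => ?_⟩
  rcases hmain with h | ⟨H, hH, h⟩
  · exact h
  · have := largeDavenport_le_smallDavenport_add_one (hab H hH)
    generalize (Nat.card (commutator G) - 2) / (p - 1) = F at h ⊢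
    omega
end

section
/- Let p be a prime and let G be a finite non-cyclic p-group (i.e. |G| is a power of p). Then D(G) ≤ ((2p − 1)/p²)·|G|. -/
section MinimalNoncyclic

variable {G : Type*} [Group G]

theorem pow_mul_eq_of_mul_eq {x y c : G} (hc : y * x = x * y * c) (hy : Commute c y) (n : ℕ) :
    y ^ n * x = x * y ^ n * c ^ n := by
  induction n with
  | zero => simp
  | succ n ih =>
    have h := (hy.symm.pow_left n).eq
    calc y ^ (n + 1) * x = y * (y ^ n * x) := by rw [pow_succ', mul_assoc]
      _ = (y * x) * (y ^ n * c ^ n) := by rw [ih]; group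
      _ = x * y * (c * y ^ n) * c ^ n := by rw [hc]; group
      _ = x * y ^ (n + 1) * c ^ (n + 1) := by rw [← h]; simp only [pow_succ']; group

theorem mul_pow_eq_of_mul_eq {x y c : G} (hc : y * x = x * y * c) (hx : Commute c x)
    (hy : Commute c y) (n : ℕ) : (x * y) ^ n = x ^ n * y ^ n * c ^ n.choose 2 := by
  induction n with
  | zero => simp
  | succ n ih =>
    have hz : Commute (c ^ n.choose 2) (x * y) := (hx.mul_right hy).pow_left _
    have hy' : Commute (c ^ n) y := hy.pow_left n
    rw [pow_succ, ih, mul_assoc, hz.eq, Nat.choose_succ_succ, Nat.choose_one_right, pow_add c]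
    calc x ^ n * y ^ n * (x * y * c ^ n.choose 2)
        = x ^ n * (y ^ n * x) * y * c ^ n.choose 2 := by group
      _ = x ^ n * x * y ^ n * (c ^ n * y) * c ^ n.choose 2 := by
          rw [pow_mul_eq_of_mul_eq hc hy]; group
      _ = x ^ (n + 1) * y ^ (n + 1) * (c ^ n * c ^ n.choose 2) := by
          rw [hy'.eq]; simp only [pow_succ]; group

variable {p k : ℕ} [hp : Fact p.Prime]

theorem exists_card_eq_pow_mem [Finite G] (hG : Nat.card G = p ^ (k + 2)) (hcyc : ¬ IsCyclic G)
    (g : G) :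
    ∃ M : Subgroup G, Nat.card M = p ^ (k + 1) ∧ g ∈ M := by
  obtain ⟨j, hj, hcard⟩ := (Nat.dvd_prime_pow hp.out).1
    (hG ▸ Subgroup.card_subgroup_dvd_card (Subgroup.zpowers g))
  have hjk : j ≤ k + 1 := by
    by_contra! h
    have : j = k + 2 := by omega
    subst this
    exact hcyc (isCyclic_iff_exists_zpowers_eq_top.2
      ⟨g, Subgroup.eq_top_of_card_eq _ (hcard.trans hG.symm)⟩)
  obtain ⟨M, hM, hle⟩ := Sylow.exists_subgroup_card_pow_prime_le p
    (hG ▸ pow_dvd_pow p (by omega : k + 1 ≤ k + 2)) (Subgroup.zpowers g) hcard hjk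
  exact ⟨M, hM, hle (Subgroup.mem_zpowers g)⟩

theorem index_eq_of_card_eq_pow (hG : Nat.card G = p ^ (k + 2)) {M : Subgroup G}
    (hM : Nat.card M = p ^ (k + 1)) : M.index = p := by
  have := M.card_mul_index
  rw [hM, hG, pow_succ p (k + 1)] at this
  exact Nat.eq_of_mul_eq_mul_left (pow_pos hp.out.pos _) this

theorem normal_of_card_eq_pow (hG : Nat.card G = p ^ (k + 2)) {M : Subgroup G}
    (hM : Nat.card M = p ^ (k + 1)) : M.Normal := by
  apply Subgroup.normal_of_index_eq_minFac_card
  rw [index_eq_of_card_eq_pow hG hM, hG, hp.out.pow_minFac (by omega)]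

theorem exists_hom_ker_eq [Finite G] (hG : Nat.card G = p ^ (k + 2)) {M : Subgroup G}
    (hM : Nat.card M = p ^ (k + 1)) :
    ∃ φ : G →* Multiplicative (ZMod p), ∀ g, φ g = 1 ↔ g ∈ M := by
  have := normal_of_card_eq_pow hG hM
  have e : G ⧸ M ≃* Multiplicative (ZMod p) := mulEquivOfPrimeCardEq (p := p)
    (index_eq_of_card_eq_pow hG hM) (by simp)
  exact ⟨e.toMonoidHom.comp (QuotientGroup.mk' M), fun g => by simp⟩

theorem exists_zpowers_eq (hG : Nat.card G = p ^ (k + 2))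
    (hprop : ∀ H : Subgroup G, H ≠ ⊤ → IsCyclic H) {M : Subgroup G}
    (hM : Nat.card M = p ^ (k + 1)) :
    ∃ w : G, Subgroup.zpowers w = M ∧ orderOf w = p ^ (k + 1) ∧ orderOf (w ^ p) = p ^ k := by
  have hne : M ≠ ⊤ := by
    rintro rfl
    rw [Subgroup.card_top, hG] at hM
    have := Nat.pow_right_injective hp.out.two_le hM
    omega
  obtain ⟨w, hw⟩ := (Subgroup.isCyclic_iff_exists_zpowers_eq_top M).1 (hprop M hne)
  have hord : orderOf w = p ^ (k + 1) := by rw [← Nat.card_zpowers, hw, hM]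
  refine ⟨w, hw, hord, ?_⟩
  rw [orderOf_pow_of_dvd hp.out.ne_zero (hord ▸ dvd_pow_self p (by omega)), hord, pow_succ,
    Nat.mul_div_cancel _ hp.out.pos]

theorem zpowers_pow_eq_inf [Finite G] (hG : Nat.card G = p ^ (k + 2)) {M₁ M₂ : Subgroup G}
    (h₁ : Nat.card M₁ = p ^ (k + 1)) (h₂ : Nat.card M₂ = p ^ (k + 1)) (hne : M₁ ≠ M₂)
    {w : G} (hw : orderOf (w ^ p) = p ^ k) : Subgroup.zpowers (w ^ p) = M₁ ⊓ M₂ := by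
  have := normal_of_card_eq_pow hG h₁
  have := normal_of_card_eq_pow hG h₂
  have hle : Subgroup.zpowers (w ^ p) ≤ M₁ ⊓ M₂ := by
    rw [Subgroup.zpowers_le]
    have hi₁ := M₁.pow_index_mem w
    have hi₂ := M₂.pow_index_mem w
    rw [index_eq_of_card_eq_pow hG h₁] at hi₁
    rw [index_eq_of_card_eq_pow hG h₂] at hi₂
    exact ⟨hi₁, hi₂⟩
  refine Subgroup.eq_of_le_of_card_ge hle ?_
  rw [Nat.card_zpowers, hw]
  obtain ⟨j, hj, hcard⟩ := (Nat.dvd_prime_pow hp.out).1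
    (h₁ ▸ Subgroup.card_dvd_of_le (inf_le_left : M₁ ⊓ M₂ ≤ M₁))
  rw [hcard]
  refine Nat.pow_le_pow_right hp.out.pos ?_
  by_contra! hlt
  have hjk : j = k + 1 := by omega
  rw [hjk] at hcard
  have e₁ := Subgroup.eq_of_le_of_card_ge (inf_le_left : M₁ ⊓ M₂ ≤ M₁) (by rw [h₁, hcard])
  have e₂ := Subgroup.eq_of_le_of_card_ge (inf_le_right : M₁ ⊓ M₂ ≤ M₂) (by rw [h₂, hcard])
  exact hne (e₁.symm.trans e₂)

theorem orderOf_eq_of_notMem_inf [Finite G] (hG : Nat.card G = p ^ (k + 2)) (hcyc : ¬ IsCyclic G)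
    (hprop : ∀ H : Subgroup G, H ≠ ⊤ → IsCyclic H) {M₁ M₂ : Subgroup G}
    (h₁ : Nat.card M₁ = p ^ (k + 1)) (h₂ : Nat.card M₂ = p ^ (k + 1)) (hne : M₁ ≠ M₂)
    {g : G} (hg : g ∉ M₁ ⊓ M₂) : orderOf g = p ^ (k + 1) := by
  obtain ⟨M, hM, hgM⟩ := exists_card_eq_pow_mem hG hcyc g
  obtain ⟨w, rfl, hw, hwp⟩ := exists_zpowers_eq hG hprop hM
  rw [← zpowers_pow_eq_inf hG h₁ h₂ hne hwp] at hg
  rw [← mem_powers_iff_mem_zpowers] at hgM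
  obtain ⟨j, rfl⟩ := hgM
  have hj : ¬ p ∣ j := by
    rintro ⟨i, rfl⟩
    exact hg (by simpa only [pow_mul] using Subgroup.npow_mem_zpowers (w ^ p) i)
  have hcop : (orderOf w).Coprime j := by
    rw [hw]
    exact Nat.Coprime.pow_left _ ((Nat.Prime.coprime_iff_not_dvd hp.out).2 hj)
  exact (hcop.orderOf_pow).trans hw

theorem minimal_noncyclic_structure [Finite G] (hG : Nat.card G = p ^ (k + 2)) (hcyc : ¬ IsCyclic G)
    (hprop : ∀ H : Subgroup G, H ≠ ⊤ → IsCyclic H) :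
    ∃ φ₁ φ₂ : G →* Multiplicative (ZMod p),
      (k = 0 ∧ ∀ g, φ₁ g = 1 → φ₂ g = 1 → g = 1) ∨
      (p = 2 ∧ k = 1 ∧ ∃ c : G, c * c = 1 ∧ ∀ g, φ₁ g = 1 → φ₂ g = 1 → g = 1 ∨ g = c) := by
  obtain ⟨M₁, h₁, -⟩ := exists_card_eq_pow_mem hG hcyc 1
  obtain ⟨y₀, hy₀⟩ : ∃ y, y ∉ M₁ := by
    by_contra! h
    rw [(Subgroup.eq_top_iff' M₁).2 h, Subgroup.card_top, hG] at h₁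
    have := Nat.pow_right_injective hp.out.two_le h₁
    omega
  obtain ⟨M₂, h₂, hy₀'⟩ := exists_card_eq_pow_mem hG hcyc y₀
  have hne : M₁ ≠ M₂ := fun h => hy₀ (h ▸ hy₀')
  have n₁ := normal_of_card_eq_pow hG h₁
  have n₂ := normal_of_card_eq_pow hG h₂
  obtain ⟨φ₁, hφ₁⟩ := exists_hom_ker_eq hG h₁
  obtain ⟨φ₂, hφ₂⟩ := exists_hom_ker_eq hG h₂
  obtain ⟨x, hxM, hx, hxp⟩ := exists_zpowers_eq hG hprop h₁
  obtain ⟨y, hyM, hy, hyp⟩ := exists_zpowers_eq hG hprop h₂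
  have hNx := zpowers_pow_eq_inf hG h₁ h₂ hne hxp
  have hNy := zpowers_pow_eq_inf hG h₁ h₂ hne hyp
  refine ⟨φ₁, φ₂, ?_⟩
  simp only [hφ₁, hφ₂]
  rcases Nat.eq_zero_or_pos k with rfl | hk
  · left
    refine ⟨rfl, fun g hg₁ hg₂ => ?_⟩
    have hg : g ∈ M₁ ⊓ M₂ := ⟨hg₁, hg₂⟩
    rw [pow_zero, orderOf_eq_one_iff] at hxp
    rwa [← hNx, hxp, Subgroup.zpowers_one_eq_bot, Subgroup.mem_bot] at hg
  right
  have hinv : (x ^ p)⁻¹ ∈ Subgroup.zpowers (y ^ p) := by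
    rw [hNy, ← hNx]
    exact inv_mem (Subgroup.mem_zpowers _)
  rw [← mem_powers_iff_mem_zpowers] at hinv
  obtain ⟨j, hj⟩ := hinv
  have hj : (y ^ j) ^ p = (x ^ p)⁻¹ := by rw [← hj]; simp only [← pow_mul, mul_comm]
  set z := y ^ j with hz
  have hzM : z ∈ M₂ := hyM ▸ Subgroup.npow_mem_zpowers y j
  have hxM' : x ∈ M₁ := hxM ▸ Subgroup.mem_zpowers x
  have hzN : z ∉ M₁ := by
    intro h
    have hzN : z ∈ Subgroup.zpowers (x ^ p) := hNx ▸ ⟨h, hzM⟩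
    have hd := orderOf_dvd_of_mem_zpowers hzN
    rw [hxp, orderOf_dvd_iff_pow_eq_one] at hd
    have hdp : orderOf (z ^ p) ∣ p ^ (k - 1) := by
      rw [orderOf_dvd_iff_pow_eq_one, ← pow_mul, ← pow_succ', Nat.sub_add_cancel hk, hd]
    rw [hj, orderOf_inv, hxp, Nat.pow_dvd_pow_iff_le_right hp.out.one_lt] at hdp
    omega
  have hxz : x * z ∉ M₁ ⊓ M₂ := fun h => hzN ((M₁.mul_mem_cancel_left hxM').1 h.1)
  have hord := orderOf_eq_of_notMem_inf hG hcyc hprop h₁ h₂ hne hxz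
  obtain ⟨c, hc⟩ : ∃ c, c = z⁻¹ * x⁻¹ * z * x := ⟨_, rfl⟩
  have hc' : z * x = x * z * c := by rw [hc]; group
  have hc₁ : c ∈ M₁ := by
    rw [hc]
    exact mul_mem (by simpa using n₁.conj_mem _ (inv_mem hxM') z⁻¹) hxM'
  have hc₂ : c ∈ M₂ := by
    rw [hc, mul_assoc, mul_assoc]
    refine mul_mem (inv_mem hzM) ?_
    simpa [mul_assoc] using n₂.conj_mem _ hzM x⁻¹
  have hcx : Commute c x := by
    rw [← hxM] at hc₁
    obtain ⟨i, rfl⟩ := hc₁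
    exact Commute.zpow_self x i
  have hcz : Commute c z := by
    rw [← hyM] at hc₂
    obtain ⟨i, hi⟩ := hc₂
    rw [← hi, hz]
    exact (Commute.refl y).zpow_left i |>.pow_right j
  have hcp : c ^ p = 1 := by
    have h := pow_mul_eq_of_mul_eq hc' hcz p
    rw [hj, (((Commute.refl x).pow_left p).inv_left).eq] at h
    simpa using h.symm
  have hpow : (x * z) ^ p = c ^ p.choose 2 := by
    rw [mul_pow_eq_of_mul_eq hc' hcx hcz, hj, mul_inv_cancel, one_mul]
  rcases hp.out.eq_two_or_odd' with rfl | hodd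
  · have h4 : (x * z) ^ 2 ^ 2 = 1 := by
      rw [show 2 ^ 2 = 2 * 2 from rfl, pow_mul, hpow]
      simpa using hcp
    have hk' := orderOf_dvd_of_pow_eq_one h4
    rw [hord, Nat.pow_dvd_pow_iff_le_right one_lt_two] at hk'
    obtain rfl : k = 1 := by omega
    have hx4 : x ^ 2 * x ^ 2 = 1 := by
      have := pow_orderOf_eq_one (x ^ 2)
      rwa [hxp, pow_one, pow_two (x ^ 2)] at this
    refine ⟨rfl, rfl, x ^ 2, hx4, fun g hg₁ hg₂ => ?_⟩
    have hg : g ∈ Subgroup.zpowers (x ^ 2) := hNx ▸ ⟨hg₁, hg₂⟩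
    classical
    rw [mem_zpowers_iff_mem_range_orderOf, hxp] at hg
    simp only [Finset.mem_image, Finset.mem_range] at hg
    obtain ⟨i, hi, rfl⟩ := hg
    obtain rfl | rfl : i = 0 ∨ i = 1 := by omega
    · left; simp
    · right; simp
  · exfalso
    have hpp : (x * z) ^ p ^ 1 = 1 := by
      obtain ⟨m, hm⟩ := hodd
      rw [pow_one, hpow, Nat.choose_two_right, hm, Nat.add_sub_cancel,
        Nat.mul_div_assoc _ (dvd_mul_right 2 m), Nat.mul_div_cancel_left _ two_pos, pow_mul, ← hm,
        hcp, one_pow]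
    have hk' := orderOf_dvd_of_pow_eq_one hpp
    rw [hord, Nat.pow_dvd_pow_iff_le_right hp.out.one_lt] at hk'
    omega

end MinimalNoncyclic

section ZeroSum

open MvPolynomial

variable {p : ℕ} [hp : Fact p.Prime]

theorem totalDegree_sum_smul_X_pow_le {ι : Type*} [Fintype ι] (a : ι → ZMod p) (n : ℕ) :
    (∑ i, a i • X i ^ n : MvPolynomial ι (ZMod p)).totalDegree ≤ n := by
  apply totalDegree_finsetSum_le
  rintro i -
  exact (totalDegree_smul_le ..).trans (totalDegree_X_pow ..).le

theorem exists_finset_sum_eq_zero {ι : Type*} [Fintype ι] (a b : ι → ZMod p)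
    (hι : 2 * p - 1 ≤ Fintype.card ι) :
    ∃ t : Finset ι, t.Nonempty ∧ ∑ i ∈ t, a i = 0 ∧ ∑ i ∈ t, b i = 0 := by
  classical
  set f₁ : MvPolynomial ι (ZMod p) := ∑ i, a i • X i ^ (p - 1)
  set f₂ : MvPolynomial ι (ZMod p) := ∑ i, b i • X i ^ (p - 1)
  have hp1 : p - 1 ≠ 0 := by have := hp.out.two_le; omega
  let zeroSol : {x // eval x f₁ = 0 ∧ eval x f₂ = 0} :=
    ⟨0, by simp [f₁, f₂, map_sum, hp1]⟩
  have hdeg : f₁.totalDegree + f₂.totalDegree < Fintype.card ι := by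
    have h₁ : f₁.totalDegree ≤ p - 1 := totalDegree_sum_smul_X_pow_le a _
    have h₂ : f₂.totalDegree ≤ p - 1 := totalDegree_sum_smul_X_pow_le b _
    have := hp.out.two_le
    omega
  obtain ⟨x, hx⟩ := Fintype.exists_ne_of_one_lt_card (hp.out.one_lt.trans_le <|
    Nat.le_of_dvd (@Fintype.card_pos _ _ ⟨zeroSol⟩) (char_dvd_card_solutions_of_add_lt p hdeg))
    zeroSol
  refine ⟨Finset.univ.filter fun i => x.1 i ≠ 0, ?_, ?_, ?_⟩
  · rw [← Subtype.coe_ne_coe, Function.ne_iff] at hx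
    exact hx.imp fun i hi => by
      simpa using show x.1 i ≠ 0 from hi
  · simpa [f₁, map_sum, smul_eval, ZMod.pow_card_sub_one, Finset.sum_filter] using x.2.1
  · simpa [f₂, map_sum, smul_eval, ZMod.pow_card_sub_one, Finset.sum_filter] using x.2.2

theorem exists_le_map_prod_eq_one {G : Type*} [Group G] (φ₁ φ₂ : G →* Multiplicative (ZMod p))
    (S : Multiset G) (hS : 2 * p - 1 ≤ Multiset.card S) :
    ∃ T ≤ S, T ≠ 0 ∧ (T.map φ₁).prod = 1 ∧ (T.map φ₂).prod = 1 := by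
  induction S using Quotient.inductionOn with | _ l
  obtain ⟨t, ht, h₁, h₂⟩ := exists_finset_sum_eq_zero
    (fun i : Fin l.length => (φ₁ (l.get i)).toAdd) (fun i => (φ₂ (l.get i)).toAdd)
    (by simpa using hS)
  refine ⟨t.val.map l.get, ?_, ?_, ?_, ?_⟩
  · have h := Multiset.map_le_map (f := l.get) (Finset.val_le_iff.2 (Finset.subset_univ t))
    rw [Fin.univ_val_map, List.ofFn_get] at h
    exact h
  · simpa using ht.ne_empty
  · rw [Multiset.map_map]
    exact h₁
  · rw [Multiset.map_map]
    exact h₂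

end ZeroSum

section Subgroup

theorem exists_list_map_eq {α β : Type*} (f : α → β) (l : List β) (M : Multiset α)
    (h : M.map f = l) : ∃ m : List α, (m : Multiset α) = M ∧ m.map f = l := by
  induction l generalizing M with
  | nil => exact ⟨[], (Multiset.map_eq_zero.1 (h.trans Multiset.coe_nil)).symm, rfl⟩
  | cons a l ih =>
    obtain ⟨b, hb, rfl⟩ := Multiset.mem_map.1 (h ▸ by simp : a ∈ M.map f)
    obtain ⟨M, rfl⟩ := Multiset.exists_cons_of_mem hb
    rw [Multiset.map_cons, ← Multiset.cons_coe, Multiset.cons_inj_right] at h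
    obtain ⟨m, rfl, rfl⟩ := ih M h
    exact ⟨b :: m, rfl, rfl⟩

theorem exists_eq_add_of_map_eq_add {α β : Type*} {f : α → β} {M : Multiset α}
    {T₁ T₂ : Multiset β} (h : M.map f = T₁ + T₂) :
    ∃ M₁ M₂, M = M₁ + M₂ ∧ M₁.map f = T₁ ∧ M₂.map f = T₂ := by
  induction T₁ using Quotient.inductionOn with | _ t₁
  induction T₂ using Quotient.inductionOn with | _ t₂
  obtain ⟨m, rfl, hm⟩ := exists_list_map_eq f (t₁ ++ t₂) M h
  obtain ⟨m₁, m₂, rfl, rfl, rfl⟩ := List.map_eq_append_iff.1 hm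
  exact ⟨m₁, m₂, rfl, rfl, rfl⟩

variable {G : Type*} [Group G] (H : Subgroup G)

theorem exists_coset_visits [Fintype (G ⧸ H)] (l : List G) (g : G) :
    ∃ v : G ⧸ H → ℕ, ∑ q, v q = l.length ∧ ∀ q, v q ≠ 0 →
      ∃ (l₀ : List G) (L : List (List G)) (l₁ : List G), l = l₀ ++ L.flatten ++ l₁ ∧
        ((g * l₀.prod : G) : G ⧸ H) = q ∧ (∀ b ∈ L, b ≠ [] ∧ b.prod ∈ H) ∧ l₁ ≠ [] ∧
        L.length + 1 = v q := by
  classical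
  induction l generalizing g with
  | nil => exact ⟨0, by simp, by simp⟩
  | cons a t ih =>
    obtain ⟨v, hv, h⟩ := ih (g * a)
    refine ⟨fun q => v q + if (g : G ⧸ H) = q then 1 else 0, ?_, fun q hq => ?_⟩
    · simp [Finset.sum_add_distrib, hv]
    by_cases hgq : (g : G ⧸ H) = q
    · by_cases hvq : v q = 0
      · exact ⟨[], [], a :: t, by simp [hgq, hvq]⟩
      · obtain ⟨t₀, L, t₁, rfl, h₀, hL, ht₁, hlen⟩ := h q hvq
        refine ⟨[], (a :: t₀) :: L, t₁, by simp, by simpa, ?_, ht₁, by simp [hgq, hlen]⟩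
        rw [← hgq, eq_comm, QuotientGroup.eq] at h₀
        rw [List.forall_mem_cons]
        exact ⟨⟨by simp, by simpa [mul_assoc] using h₀⟩, hL⟩
    · simp only [hgq, if_false, add_zero] at hq ⊢
      obtain ⟨t₀, L, t₁, rfl, h₀, hL, ht₁, hlen⟩ := h q hq
      exact ⟨a :: t₀, L, t₁, by simp, by simpa [mul_assoc] using h₀, hL, ht₁, hlen⟩

/-- A word with product one can be rotated and cut into nonempty factors with products in `H`,
using at least `l.length / H.index` factors. -/
theorem exists_flatten_perm [Finite G] (l : List G) (hl : l.prod = 1) (hne : l ≠ []) :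
    ∃ L : List (List G), L.flatten.Perm l ∧ L.flatten.prod = 1 ∧
      (∀ b ∈ L, b ≠ [] ∧ b.prod ∈ H) ∧ l.length ≤ H.index * L.length := by
  have := Fintype.ofFinite (G ⧸ H)
  obtain ⟨v, hv, h⟩ := exists_coset_visits H l 1
  obtain ⟨q, hq⟩ : ∃ q, l.length ≤ H.index * v q := by
    by_contra! hlt
    have hsum : ∑ q, H.index * v q < ∑ _q : G ⧸ H, l.length :=
      Finset.sum_lt_sum_of_nonempty Finset.univ_nonempty fun q _ => hlt q
    rw [← Finset.mul_sum, hv, Finset.sum_const, Finset.card_univ, smul_eq_mul,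
      ← Nat.card_eq_fintype_card, ← Subgroup.index] at hsum
    exact hsum.false
  have hvq : v q ≠ 0 := by
    intro h0
    rw [h0, mul_zero, Nat.le_zero, List.length_eq_zero_iff] at hq
    exact hne hq
  obtain ⟨l₀, L, l₁, rfl, -, hL, hl₁, hlen⟩ := h q hvq
  have hprod : L.flatten.prod * (l₁ ++ l₀).prod = 1 := by
    simp only [List.prod_append] at hl ⊢
    have h' : L.flatten.prod * l₁.prod = l₀.prod⁻¹ :=
      eq_inv_of_mul_eq_one_right (by rw [← mul_assoc]; exact hl)
    rw [← mul_assoc, h', inv_mul_cancel]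
  have hF : L.flatten.prod ∈ H := by
    rw [List.prod_flatten]
    refine H.list_prod_mem fun x hx => ?_
    obtain ⟨b, hb, rfl⟩ := List.mem_map.1 hx
    exact (hL b hb).2
  refine ⟨L ++ [l₁ ++ l₀], ?_, ?_, ?_, by simpa [hlen] using hq⟩
  · rw [List.flatten_append, List.flatten_singleton, ← List.append_assoc]
    refine List.perm_append_comm.trans ?_
    rw [List.append_assoc]
  · rw [List.flatten_append, List.flatten_singleton, List.prod_append, hprod]
  · rw [List.forall_mem_append, List.forall_mem_singleton]
    refine ⟨hL, by simp [hl₁], ?_⟩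
    rw [← inv_eq_of_mul_eq_one_right hprod]
    exact inv_mem hF

variable {H}

theorem isProductOne_sum_of_map {f : List G → H} {M : Multiset (List G)}
    (hf : ∀ b ∈ M, (f b : G) = b.prod) (h : IsProductOne (M.map f)) :
    IsProductOne (M.map Multiset.ofList).sum := by
  obtain ⟨l, hl, hprod⟩ := h
  obtain ⟨m, rfl, rfl⟩ := exists_list_map_eq f l M hl.symm
  refine ⟨m.flatten, (Multiset.coe_join m).symm, ?_⟩
  rw [List.prod_flatten, ← List.map_congr_left (fun b hb => hf b hb)]
  simpa [Function.comp_def] using congrArg H.subtype hprod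

theorem IsMinimalProductOne.exists_subgroup [Finite G] {S : Multiset G}
    (hS : IsMinimalProductOne S) (H : Subgroup G) :
    ∃ T : Multiset H, IsMinimalProductOne T ∧
      Multiset.card S ≤ H.index * Multiset.card T := by
  classical
  obtain ⟨hne, ⟨l, rfl, hl⟩, hmin⟩ := hS
  obtain ⟨L, hperm, hprod, hL, hlen⟩ := exists_flatten_perm H l hl (by simpa using hne)
  let f : List G → H := fun b => if h : b.prod ∈ H then ⟨b.prod, h⟩ else 1
  have hf : ∀ b ∈ L, (f b : G) = b.prod := fun b hb => by simp [f, (hL b hb).2]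
  refine ⟨(L.map f : List H), ⟨?_, ⟨L.map f, rfl, ?_⟩, ?_⟩, by simpa using hlen⟩
  · rintro h
    obtain rfl : L = [] := by simpa using h
    exact hne (by simpa using hlen)
  · apply H.subtype_injective
    rw [map_one, ← hprod, List.prod_flatten, ← List.map_congr_left (fun b hb => hf b hb)]
    simp [Function.comp_def]
  · rintro ⟨T₁, T₂, h₁, h₂, hT, hp₁, hp₂⟩
    rw [← Multiset.map_coe] at hT
    obtain ⟨M₁, M₂, hM, rfl, rfl⟩ := exists_eq_add_of_map_eq_add hT
    have hmem : ∀ b, b ∈ M₁ ∨ b ∈ M₂ → b ∈ L := fun b hb => by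
      rwa [← Multiset.mem_coe, hM, Multiset.mem_add]
    have key : ∀ M : Multiset (List G), (∀ b ∈ M, b ∈ L) → M.map f ≠ 0 →
        (M.map Multiset.ofList).sum ≠ 0 := by
      intro M hML hM0 h0
      obtain ⟨b, hb⟩ := Multiset.exists_mem_of_ne_zero (by simpa using hM0 : M ≠ 0)
      have := Multiset.sum_eq_zero_iff.1 h0 _ (Multiset.mem_map_of_mem _ hb)
      exact (hL b (hML b hb)).1 (by simpa using this)
    refine hmin ⟨_, _, key M₁ (fun b hb => hmem b (.inl hb)) h₁,
      key M₂ (fun b hb => hmem b (.inr hb)) h₂, ?_,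
      isProductOne_sum_of_map (fun b hb => hf b (hmem b (.inl hb))) hp₁,
      isProductOne_sum_of_map (fun b hb => hf b (hmem b (.inr hb))) hp₂⟩
    rw [← Multiset.sum_add, ← Multiset.map_add, ← hM, ← Multiset.coe_eq_coe.2 hperm]
    exact (Multiset.coe_join L).symm

end Subgroup

section Splitting

variable {G : Type*} [Group G] {p : ℕ} [hp : Fact p.Prime]

theorem IsProductOne.of_add_of_commute {T U : Multiset G} (hS : IsProductOne (T + U))
    (hcomm : ∀ x ∈ T + U, ∀ y ∈ T + U, x * y = y * x) (hT : IsProductOne T) :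
    IsProductOne U := by
  obtain ⟨l, hl, hl1⟩ := hS
  obtain ⟨t, rfl, ht⟩ := hT
  induction U using Quotient.inductionOn with | _ u
  refine ⟨u, rfl, ?_⟩
  have hperm : l.Perm (t ++ u) := Multiset.coe_eq_coe.1 hl
  have hprod := hperm.prod_eq' (List.pairwise_of_forall_mem_list fun x hx y hy =>
    hcomm x (hl ▸ hx) y (hl ▸ hy))
  rwa [hl1, List.prod_append, ht, one_mul, eq_comm] at hprod

theorem IsProductOne.map_prod_eq_one {A : Type*} [CommGroup A] {S : Multiset G}
    (h : IsProductOne S) (φ : G →* A) : (S.map φ).prod = 1 := by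
  obtain ⟨l, rfl, hl⟩ := h
  rw [Multiset.map_coe, Multiset.prod_coe, ← map_list_prod, hl, map_one]

theorem IsMinimalProductOne.not_isProductOne_add {T U : Multiset G}
    (hS : IsMinimalProductOne (T + U)) (hT : T ≠ 0) (hU : U ≠ 0) (hT1 : IsProductOne T) :
    ¬ IsProductOne U :=
  fun hU1 => hS.2.2 ⟨T, U, hT, hU, rfl, hT1, hU1⟩

theorem card_le_of_ker_eq_one (φ₁ φ₂ : G →* Multiplicative (ZMod p))
    (hφ : ∀ g, φ₁ g = 1 → φ₂ g = 1 → g = 1) {S : Multiset G} (hS : IsMinimalProductOne S) :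
    Multiset.card S ≤ 2 * p - 1 := by
  by_contra! hlt
  obtain ⟨s, hs⟩ := Multiset.exists_mem_of_ne_zero hS.1
  obtain ⟨R, rfl⟩ := Multiset.exists_cons_of_mem hs
  rw [Multiset.card_cons] at hlt
  obtain ⟨T, hTR, hT, h₁, h₂⟩ := exists_le_map_prod_eq_one φ₁ φ₂ R (by omega)
  obtain ⟨U, rfl⟩ := Multiset.le_iff_exists_add.1 hTR
  have hcomm : ∀ x y : G, x * y = y * x := fun x y => by
    have h (φ : G →* Multiplicative (ZMod p)) : φ (x * y * (y * x)⁻¹) = 1 := by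
      rw [map_mul, map_inv, map_mul, map_mul, mul_comm (φ x), mul_inv_cancel]
    exact mul_inv_eq_one.1 (hφ _ (h φ₁) (h φ₂))
  have hT1 : IsProductOne T := by
    induction T using Quotient.inductionOn with | _ t
    refine ⟨t, rfl, hφ _ ?_ ?_⟩
    · simpa [map_list_prod] using h₁
    · simpa [map_list_prod] using h₂
  rw [← Multiset.add_cons] at hS
  exact hS.not_isProductOne_add hT Multiset.cons_ne_zero hT1
    (hS.2.1.of_add_of_commute (fun x _ y _ => hcomm x y) hT1)

variable {φ₁ φ₂ : G →* Multiplicative (ZMod 2)} {c : G}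

theorem exists_le_isProductOne_of_five_le (hc : c * c = 1)
    (hφ : ∀ g, φ₁ g = 1 → φ₂ g = 1 → g = 1 ∨ g = c) (R : Multiset G)
    (hR : 5 ≤ Multiset.card R) : ∃ T ≤ R, T ≠ 0 ∧ IsProductOne T := by
  induction R using Quotient.inductionOn with | _ l
  have hdup : ¬ (l.map fun g => (φ₁ g, φ₂ g)).Nodup := fun h => by
    have hle := h.length_le_card
    have hcard : Fintype.card (Multiplicative (ZMod 2) × Multiplicative (ZMod 2)) = 4 := rfl
    rw [List.length_map, hcard] at hle
    exact absurd (hR.trans hle) (by norm_num)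
  obtain ⟨x, hx⟩ := List.exists_duplicate_iff_not_nodup.2 hdup
  obtain ⟨l', hl', hxl'⟩ := List.sublist_map_iff.1 (List.duplicate_iff_sublist.1 hx)
  obtain ⟨g, h, rfl, hg, hh⟩ : ∃ g h, l' = [g, h] ∧ (φ₁ g, φ₂ g) = x ∧ (φ₁ h, φ₂ h) = x := by
    match l', hxl' with
    | [g, h], he =>
      simp only [List.map_cons, List.map_nil, List.cons.injEq, and_true] at he
      exact ⟨g, h, rfl, he.1.symm, he.2.symm⟩
    | [], he | [_], he | _ :: _ :: _ :: _, he => simp at he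
  obtain ⟨hgh₁, hgh₂⟩ := Prod.mk.inj (hg.trans hh.symm)
  obtain ⟨U, hU⟩ := Multiset.le_iff_exists_add.1 (Multiset.coe_le.2 hl'.subperm)
  have hUcard : 3 ≤ Multiset.card U := by
    have h := congrArg Multiset.card hU
    simp only [Multiset.card_add, Multiset.coe_card, List.length_cons, List.length_nil] at h
    have hR' : 5 ≤ l.length := hR
    omega
  have hsq : ∀ a : Multiplicative (ZMod 2), a * a = 1 := by decide
  have hgh := hφ (g * h) (by rw [map_mul, hgh₁, hsq]) (by rw [map_mul, hgh₂, hsq])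
  obtain ⟨T, hTU, hT, h₁, h₂⟩ := exists_le_map_prod_eq_one φ₁ φ₂ U hUcard
  induction T using Quotient.inductionOn with | _ t
  have ht := hφ t.prod (by simpa [map_list_prod] using h₁) (by simpa [map_list_prod] using h₂)
  change ∃ T ≤ (l : Multiset G), _
  rw [hU]
  rcases hgh with hgh | hgh
  · exact ⟨_, Multiset.le_add_right _ _, by simp, [g, h], rfl, by simpa using hgh⟩
  rcases ht with ht | ht
  · exact ⟨_, hTU.trans (Multiset.le_add_left _ _), hT, t, rfl, ht⟩
  · refine ⟨_, add_le_add_right hTU _, by simp, [g, h] ++ t, rfl, ?_⟩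
    simp [← mul_assoc, hgh, ht, hc]

theorem card_le_six_of_ker_eq_pair (hc : c * c = 1)
    (hφ : ∀ g, φ₁ g = 1 → φ₂ g = 1 → g = 1 ∨ g = c) {S : Multiset G}
    (hS : IsMinimalProductOne S) : Multiset.card S ≤ 6 := by
  by_contra! hlt
  by_cases hcomm : ∀ x ∈ S, ∀ y ∈ S, x * y = y * x
  · obtain ⟨s, hs⟩ := Multiset.exists_mem_of_ne_zero hS.1
    obtain ⟨R, rfl⟩ := Multiset.exists_cons_of_mem hs
    rw [Multiset.card_cons] at hlt
    obtain ⟨T, hTR, hT, hT1⟩ := exists_le_isProductOne_of_five_le hc hφ R (by omega)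
    obtain ⟨U, rfl⟩ := Multiset.le_iff_exists_add.1 hTR
    rw [← Multiset.add_cons] at hS hcomm
    exact hS.not_isProductOne_add hT Multiset.cons_ne_zero hT1
      (hS.2.1.of_add_of_commute hcomm hT1)
  · push Not at hcomm
    obtain ⟨x, hx, y, hy, hxy⟩ := hcomm
    obtain ⟨R, rfl⟩ := Multiset.exists_cons_of_mem hx
    obtain ⟨R, rfl⟩ := Multiset.exists_cons_of_mem
      ((Multiset.mem_cons.1 hy).resolve_left fun h => hxy (by rw [h]))
    rw [Multiset.card_cons, Multiset.card_cons] at hlt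
    obtain ⟨T, hTR, hT, hT1⟩ := exists_le_isProductOne_of_five_le hc hφ R (by omega)
    obtain ⟨U, rfl⟩ := Multiset.le_iff_exists_add.1 hTR
    rw [← Multiset.add_cons, ← Multiset.add_cons] at hS
    refine hS.not_isProductOne_add hT Multiset.cons_ne_zero hT1 ?_
    induction U using Quotient.inductionOn with | _ u
    have hker : ∀ φ : G →* Multiplicative (ZMod 2), φ x * (φ y * φ u.prod) = 1 := fun φ => by
      have h := hS.2.1.map_prod_eq_one φ
      rw [Multiset.map_add, Multiset.prod_add, hT1.map_prod_eq_one φ, one_mul] at h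
      simpa [map_list_prod] using h
    have hxyu := hφ (x * y * u.prod) (by simpa [mul_assoc] using hker φ₁)
      (by simpa [mul_assoc] using hker φ₂)
    have hyxu := hφ (y * x * u.prod) (by simpa [mul_assoc, mul_left_comm] using hker φ₁)
      (by simpa [mul_assoc, mul_left_comm] using hker φ₂)
    rcases hxyu with h | h
    · exact ⟨x :: y :: u, rfl, by simpa [mul_assoc] using h⟩
    rcases hyxu with h' | h'
    · exact ⟨y :: x :: u, Multiset.coe_eq_coe.2 (List.Perm.swap x y u),
        by simpa [mul_assoc] using h'⟩
    · exact absurd (mul_right_cancel (h.trans h'.symm)) hxy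

end Splitting

theorem IsMinimalProductOne.sq_mul_card_le {G : Type*} [Group G] [Finite G] {p n : ℕ}
    [hp : Fact p.Prime] (hG : Nat.card G = p ^ n) (hcyc : ¬ IsCyclic G) {S : Multiset G}
    (hS : IsMinimalProductOne S) :
    p ^ 2 * Multiset.card S ≤ (2 * p - 1) * Nat.card G := by
  induction n using Nat.strong_induction_on generalizing G with | _ n ih
  by_cases hprop : ∀ H : Subgroup G, H ≠ ⊤ → IsCyclic H
  · obtain ⟨k, rfl⟩ : ∃ k, n = k + 2 := by
      match n, hG with
      | 0, hG =>
        have := (Nat.card_eq_one_iff_unique.1 (hG.trans (pow_zero p))).1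
        exact absurd isCyclic_of_subsingleton hcyc
      | 1, hG => exact absurd (isCyclic_of_prime_card (hG.trans (pow_one p))) hcyc
      | k + 2, _ => exact ⟨k, rfl⟩
    obtain ⟨φ₁, φ₂, ⟨rfl, hφ⟩ | ⟨rfl, rfl, c, hc, hφ⟩⟩ := minimal_noncyclic_structure hG hcyc hprop
    · rw [hG, mul_comm, zero_add]
      gcongr
      exact card_le_of_ker_eq_one φ₁ φ₂ hφ hS
    · have := card_le_six_of_ker_eq_pair hc hφ hS
      rw [hG]
      omega
  · push Not at hprop
    obtain ⟨H, hH, hHcyc⟩ := hprop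
    obtain ⟨m, hm, hcard⟩ := (Nat.dvd_prime_pow hp.out).1 (hG ▸ Subgroup.card_subgroup_dvd_card H)
    have hmn : m < n := lt_of_le_of_ne hm fun h =>
      hH (Subgroup.eq_top_of_card_eq H (by rw [hcard, hG, h]))
    obtain ⟨T, hT, hle⟩ := hS.exists_subgroup H
    calc p ^ 2 * Multiset.card S ≤ p ^ 2 * (H.index * Multiset.card T) := by gcongr
      _ = H.index * (p ^ 2 * Multiset.card T) := by ring
      _ ≤ H.index * ((2 * p - 1) * Nat.card H) :=
        Nat.mul_le_mul_left _ (ih m hmn hcard hHcyc hT)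
      _ = (2 * p - 1) * Nat.card G := by rw [← H.card_mul_index]; ring

theorem stmt4 (G : Type*) [Group G] [Finite G] (p : ℕ) (hp : p.Prime)
    (hpgroup : ∃ n : ℕ, Nat.card G = p ^ n)
    (hcyc : ¬ IsCyclic G) :
    p ^ 2 * largeDavenport G ≤ (2 * p - 1) * Nat.card G := by
  obtain ⟨n, hn⟩ := hpgroup
  have : Fact p.Prime := ⟨hp⟩
  rw [mul_comm, ← Nat.le_div_iff_mul_le (pow_pos hp.pos 2)]
  refine csSup_le' ?_
  rintro _ ⟨S, rfl, hS⟩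
  rw [Nat.le_div_iff_mul_le (pow_pos hp.pos 2), mul_comm]
  exact hS.sq_mul_card_le hn hcyc
end
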